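/- Let K be a field, R = K[x_1,…,x_d] a polynomial ring in d > 0 indeterminates, m, n integers with 1 ≤ m ≤ n, and A an m×n matrix over R such that I = I_m(A) is of generic height, i.e. ht I = n−m+1. Let X be a generic m×n matrix over R, B = R[X], J = I_m(X), and let N be the B-ideal generated by the entries of X − A; regard R as a B-algebra via the isomorphism B/N ≅ R (sending X_{ij} to A_{ij}). If ht I_j(A) ≥ (m−j+1)(n−m)+1 for all 1 ≤ j ≤ m−1, then for every positive integer k the natural surjection J^k ⊗_B R → I^k is an isomorphism of R-modules; equivalently, the natural map R[Ju] ⊗_B R → R[Iu] between Rees algebras is an isomorphism. -/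

import Mathlib

open Matrix

/-- The ideal generated by the `t × t` minors of a matrix. -/
noncomputable def minorsIdeal {R : Type*} [CommRing R] {α β : Type*}
    (t : ℕ) (A : Matrix α β R) : Ideal R :=
  Ideal.span {d : R | ∃ (f : Fin t → α) (g : Fin t → β),
    Function.Injective f ∧ Function.Injective g ∧ d = (A.submatrix f g).det}

/-- The height of an ideal: the infimum of the heights of primes containing it. -/
noncomputable def idealHeight {R : Type*} [CommRing R] (I : Ideal R) : ℕ∞ :=
  ⨅ p ∈ {p : PrimeSpectrum R | I ≤ p.asIdeal}, Order.height p

/-- The minimal number of generators of an ideal. -/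
noncomputable def mu {R : Type*} [CommRing R] (I : Ideal R) : ℕ :=
  sInf {n : ℕ | ∃ s : Finset R, s.card = n ∧ Ideal.span (s : Set R) = I}

/-- The condition `G_s`. -/
def SatisfiesG {R : Type*} [CommRing R] (I : Ideal R) (s : ℕ) : Prop :=
  ∀ (p : Ideal R) (hp : p.IsPrime), I ≤ p →
    haveI := hp
    ringKrullDim (Localization.AtPrime p) ≤ ((s - 1 : ℕ) : WithBot ℕ∞) →
    (mu (I.map (algebraMap R (Localization.AtPrime p))) : WithBot ℕ∞) ≤
      ringKrullDim (Localization.AtPrime p)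

section TorVanishing

universe u

/-- A short exact sequence `0 → N' → F → N → 0`. -/
structure IsSES {B : Type u} [CommRing B] {N' F N : Type u} [AddCommGroup N'] [Module B N']
    [AddCommGroup F] [Module B F] [AddCommGroup N] [Module B N]
    (f : N' →ₗ[B] F) (g : F →ₗ[B] N) : Prop where
  inj : Function.Injective f
  exact : Function.Exact f g
  surj : Function.Surjective g

/-- The free module on the underlying set of `N`. -/
def FreeCover (B N : Type u) [CommRing B] : Type u := N →₀ B

noncomputable instance (B N : Type u) [CommRing B] : AddCommGroup (FreeCover B N) :=
  Finsupp.instAddCommGroup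

noncomputable instance (B N : Type u) [CommRing B] : Module B (FreeCover B N) :=
  Finsupp.module N B

instance (B N : Type u) [CommRing B] : Module.Free B (FreeCover B N) :=
  Module.Free.finsupp (R := B) (M := B) N

/-- The canonical surjection from a free module onto `N`. -/
noncomputable def freeCoverMap (B : Type u) [CommRing B] (N : Type u) [AddCommGroup N]
    [Module B N] : FreeCover B N →ₗ[B] N :=
  Finsupp.linearCombination B (id : N → N)

/-- The first syzygy module of `N` with respect to the canonical free cover. -/
noncomputable abbrev Syz (B : Type u) [CommRing B] (N : Type u) [AddCommGroup N] [Module B N] :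
    Submodule B (FreeCover B N) :=
  LinearMap.ker (freeCoverMap B N)

/-- `TorVan B E i N` says that `Tor_{i+1}(E, N)` vanishes. -/
def TorVan (B : Type u) [CommRing B] (E : Type u) [AddCommGroup E] [Module B E] :
    ℕ → (N : Type u) → [AddCommGroup N] → [Module B N] → Prop
  | 0, N, _, _ => Function.Injective ((Syz B N).subtype.lTensor E)
  | i + 1, N, _, _ => TorVan B E i (Syz B N)

/-- `TorTorsion B E φ i N` says that every element of `Tor_{i+1}(E, N)` is killed by a power of the
endomorphism `φ` of `E`. -/
def TorTorsion (B : Type u) [CommRing B] (E : Type u) [AddCommGroup E] [Module B E]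
    (φ : E →ₗ[B] E) : ℕ → (N : Type u) → [AddCommGroup N] → [Module B N] → Prop
  | 0, N, _, _ => ∀ x : TensorProduct B E (Syz B N), (Syz B N).subtype.lTensor E x = 0 →
      ∃ n : ℕ, (φ ^ n).rTensor (Syz B N) x = 0
  | i + 1, N, _, _ => TorTorsion B E φ i (Syz B N)

variable {B : Type u} [CommRing B]
variable {N' F N E' G E : Type u}
  [AddCommGroup N'] [Module B N'] [AddCommGroup F] [Module B F] [AddCommGroup N] [Module B N]
  [AddCommGroup E'] [Module B E'] [AddCommGroup G] [Module B G] [AddCommGroup E] [Module B E]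

lemma isSES_syz (N : Type u) [AddCommGroup N] [Module B N] :
    IsSES (Syz B N).subtype (freeCoverMap B N) where
  inj := Subtype.val_injective
  exact := LinearMap.exact_subtype_ker_map _
  surj := Finsupp.linearCombination_id_surjective B N

lemma lTensor_rTensor_comm (f : E' →ₗ[B] G) (ι : N' →ₗ[B] F) (x : TensorProduct B E' N') :
    f.rTensor F (ι.lTensor E' x) = ι.lTensor G (f.rTensor N' x) := by
  rw [← LinearMap.comp_apply, ← LinearMap.comp_apply, LinearMap.rTensor_comp_lTensor,
    LinearMap.lTensor_comp_rTensor]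

/-- In the grid of tensor products of two right exact sequences, injectivity of one end map
transfers to the other end. -/
lemma rTensor_injective_of_lTensor {f : E' →ₗ[B] G} {g : G →ₗ[B] E} {ι : N' →ₗ[B] F}
    {π : F →ₗ[B] N} (hfg : Function.Exact f g) (hg : Function.Surjective g)
    (hιπ : Function.Exact ι π) (hπ : Function.Surjective π)
    (hF : Function.Injective (f.rTensor F)) (h : Function.Injective (ι.lTensor E)) :
    Function.Injective (f.rTensor N) := by
  rw [injective_iff_map_eq_zero]
  intro x hx
  obtain ⟨w, rfl⟩ := LinearMap.lTensor_surjective E' hπ x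
  rw [lTensor_rTensor_comm] at hx
  obtain ⟨y, hy⟩ := (lTensor_exact G hιπ hπ _).1 hx
  have h3 : g.rTensor N' y = 0 := by
    apply (injective_iff_map_eq_zero _).1 h
    rw [← lTensor_rTensor_comm, hy]
    exact (rTensor_exact F hfg hg).apply_apply_eq_zero w
  obtain ⟨z, rfl⟩ := (rTensor_exact N' hfg hg _).1 h3
  rw [← lTensor_rTensor_comm] at hy
  rw [← hF hy]
  exact (lTensor_exact E' hιπ hπ).apply_apply_eq_zero z

lemma lTensor_injective_of_rTensor {f : E' →ₗ[B] G} {g : G →ₗ[B] E} {ι : N' →ₗ[B] F}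
    {π : F →ₗ[B] N} (hfg : Function.Exact f g) (hg : Function.Surjective g)
    (hιπ : Function.Exact ι π) (hπ : Function.Surjective π)
    (hG : Function.Injective (ι.lTensor G)) (h : Function.Injective (f.rTensor N)) :
    Function.Injective (ι.lTensor E) := by
  rw [injective_iff_map_eq_zero]
  intro x hx
  obtain ⟨w, rfl⟩ := LinearMap.rTensor_surjective N' hg x
  rw [← lTensor_rTensor_comm] at hx
  obtain ⟨y, hy⟩ := (rTensor_exact F hfg hg _).1 hx
  have h3 : π.lTensor E' y = 0 := by
    apply (injective_iff_map_eq_zero _).1 h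
    rw [lTensor_rTensor_comm, hy]
    exact (lTensor_exact G hιπ hπ).apply_apply_eq_zero w
  obtain ⟨z, rfl⟩ := (lTensor_exact E' hιπ hπ _).1 h3
  rw [lTensor_rTensor_comm] at hy
  rw [← hG hy]
  exact (rTensor_exact N' hfg hg).apply_apply_eq_zero z

lemma lTensor_injective_iff_rTensor {f : E' →ₗ[B] G} {g : G →ₗ[B] E} {ι : N' →ₗ[B] F}
    {π : F →ₗ[B] N} (h₁ : IsSES f g) (h₂ : IsSES ι π) [Module.Flat B G] [Module.Flat B F] :
    Function.Injective (ι.lTensor E) ↔ Function.Injective (f.rTensor N) :=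
  ⟨rTensor_injective_of_lTensor h₁.exact h₁.surj h₂.exact h₂.surj
    (Module.Flat.rTensor_preserves_injective_linearMap f h₁.inj),
   lTensor_injective_of_rTensor h₁.exact h₁.surj h₂.exact h₂.surj
    (Module.Flat.lTensor_preserves_injective_linearMap ι h₂.inj)⟩

lemma torVan_zero_iff_rTensor {f : E' →ₗ[B] G} {g : G →ₗ[B] E} (h : IsSES f g)
    [Module.Flat B G] : TorVan B E 0 N ↔ Function.Injective (f.rTensor N) :=
  lTensor_injective_iff_rTensor h (isSES_syz N)

lemma torVan_zero_iff_lTensor {ι : N' →ₗ[B] F} {π : F →ₗ[B] N} (h : IsSES ι π)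
    [Module.Flat B F] : TorVan B E 0 N ↔ Function.Injective (ι.lTensor E) :=
  (torVan_zero_iff_rTensor (isSES_syz E)).trans
    (lTensor_injective_iff_rTensor (isSES_syz E) h).symm

lemma rTensor_injective_iff_lTensor_of_flat {f : E' →ₗ[B] G} {ι : N' →ₗ[B] F}
    (hf : Function.Injective f) (hι : Function.Injective ι) [Module.Flat B G] [Module.Flat B F] :
    Function.Injective (f.rTensor N') ↔ Function.Injective (ι.lTensor E') := by
  have h₁ : Function.Injective (ι.lTensor G) :=
    Module.Flat.lTensor_preserves_injective_linearMap ι hι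
  have h₂ : Function.Injective (f.rTensor F) :=
    Module.Flat.rTensor_preserves_injective_linearMap f hf
  rw [← h₁.of_comp_iff, ← h₂.of_comp_iff, ← LinearMap.coe_comp, ← LinearMap.coe_comp,
    LinearMap.rTensor_comp_lTensor, LinearMap.lTensor_comp_rTensor]

lemma torVan_succ_iff_left {f : E' →ₗ[B] G} {g : G →ₗ[B] E} (h : IsSES f g)
    [Module.Flat B G] (i : ℕ) : ∀ (N : Type u) [AddCommGroup N] [Module B N],
    TorVan B E (i + 1) N ↔ TorVan B E' i N := by
  induction i with
  | zero =>
    intro N _ _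
    change TorVan B E 0 (Syz B N) ↔ _
    rw [torVan_zero_iff_rTensor h, torVan_zero_iff_lTensor (isSES_syz N)]
    exact rTensor_injective_iff_lTensor_of_flat h.inj (isSES_syz N).inj
  | succ i ih => exact fun N _ _ => ih (Syz B N)

lemma torVan_succ_iff_right {ι : N' →ₗ[B] F} {π : F →ₗ[B] N} (h : IsSES ι π)
    [Module.Flat B F] (i : ℕ) : ∀ (E : Type u) [AddCommGroup E] [Module B E],
    TorVan B E (i + 1) N ↔ TorVan B E i N' := by
  induction i with
  | zero =>
    intro E _ _
    rw [torVan_succ_iff_left (isSES_syz E), torVan_zero_iff_lTensor h,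
      torVan_zero_iff_rTensor (isSES_syz E)]
    exact (rTensor_injective_iff_lTensor_of_flat (isSES_syz E).inj h.inj).symm
  | succ i ih =>
    intro E _ _
    rw [torVan_succ_iff_left (isSES_syz E), ih, ← torVan_succ_iff_left (isSES_syz E)]

lemma IsSES.comp_equiv {ι : N' →ₗ[B] F} {π : F →ₗ[B] N} (h : IsSES ι π) (e : N ≃ₗ[B] E) :
    IsSES ι (e.toLinearMap ∘ₗ π) where
  inj := h.inj
  exact := fun x => by simp [← h.exact x]
  surj := e.surjective.comp h.surj

lemma torVan_congr_right (e : N ≃ₗ[B] N') (i : ℕ) : TorVan B E i N ↔ TorVan B E i N' := by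
  have h := (isSES_syz N).comp_equiv e
  cases i with
  | zero => rw [torVan_zero_iff_lTensor h]; rfl
  | succ i => rw [torVan_succ_iff_right h]; rfl

lemma torVan_comm (i : ℕ) : ∀ (E N : Type u) [AddCommGroup E] [Module B E] [AddCommGroup N]
    [Module B N], TorVan B E i N ↔ TorVan B N i E := by
  induction i with
  | zero =>
    intro E N _ _ _ _
    rw [torVan_zero_iff_rTensor (isSES_syz E), torVan_zero_iff_lTensor (isSES_syz E),
      LinearMap.lTensor_inj_iff_rTensor_inj]
  | succ i ih =>
    intro E N _ _ _ _
    rw [torVan_succ_iff_left (isSES_syz E), ih]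
    rfl

lemma torVan_of_flat_left [Module.Flat B E] (i : ℕ) : ∀ (N : Type u) [AddCommGroup N] [Module B N],
    TorVan B E i N := by
  induction i with
  | zero => exact fun N _ _ => Module.Flat.lTensor_preserves_injective_linearMap _ (isSES_syz N).inj
  | succ i ih => exact fun N _ _ => ih _

lemma torVan_iff_torTorsion_id (i : ℕ) : ∀ (N : Type u) [AddCommGroup N] [Module B N],
    TorVan B E i N ↔ TorTorsion B E LinearMap.id i N := by
  induction i with
  | zero =>
    intro N _ _
    change Function.Injective _ ↔ _
    rw [injective_iff_map_eq_zero]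
    refine forall₂_congr fun x _ => ⟨fun h => ⟨0, by simp [h]⟩, ?_⟩
    rintro ⟨n, hn⟩
    have : (LinearMap.id : E →ₗ[B] E) ^ n = LinearMap.id := one_pow n
    simpa [this] using hn
  | succ i ih => exact fun N _ _ => ih _

lemma rTensor_pow_comm {f : E' →ₗ[B] G} {φ : E' →ₗ[B] E'} {χ : G →ₗ[B] G}
    (h : f ∘ₗ φ = χ ∘ₗ f) (n : ℕ) (M : Type u) [AddCommGroup M] [Module B M]
    (x : TensorProduct B E' M) :
    f.rTensor M ((φ ^ n).rTensor M x) = (χ ^ n).rTensor M (f.rTensor M x) := by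
  have : f ∘ₗ (φ ^ n) = (χ ^ n) ∘ₗ f := by
    induction n with
    | zero => rfl
    | succ n ih =>
      rw [pow_succ, pow_succ, Module.End.mul_eq_comp, Module.End.mul_eq_comp,
        ← LinearMap.comp_assoc, ih, LinearMap.comp_assoc, h, LinearMap.comp_assoc]
  rw [← LinearMap.rTensor_comp_apply, this, LinearMap.rTensor_comp_apply]

lemma torTorsion_succ_of_isSES {f : E' →ₗ[B] G} {g : G →ₗ[B] E} (h : IsSES f g)
    {φ' : E' →ₗ[B] E'} {φ : G →ₗ[B] G} {φ'' : E →ₗ[B] E} (hf : f ∘ₗ φ' = φ ∘ₗ f)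
    (hg : g ∘ₗ φ = φ'' ∘ₗ g) (i : ℕ) : ∀ (N : Type u) [AddCommGroup N] [Module B N],
    TorTorsion B E' φ' i N → TorTorsion B G φ (i + 1) N → TorTorsion B E φ'' (i + 1) N := by
  induction i with
  | succ i ih => exact fun N _ _ => ih _
  | zero =>
    intro N _ _ h₁ h₂ x hx
    have hL := isSES_syz (B := B) (Syz B N)
    obtain ⟨y, rfl⟩ := LinearMap.rTensor_surjective _ h.surj x
    rw [← lTensor_rTensor_comm] at hx
    obtain ⟨w, hw⟩ := (rTensor_exact _ h.exact h.surj _).1 hx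
    obtain ⟨n, hn⟩ := h₁ ((freeCoverMap B (Syz B N)).lTensor E' w) <| by
      have hinj : Function.Injective (f.rTensor (FreeCover B N)) :=
        Module.Flat.rTensor_preserves_injective_linearMap f h.inj
      apply (injective_iff_map_eq_zero _).1 hinj
      rw [lTensor_rTensor_comm, lTensor_rTensor_comm, hw,
        (lTensor_exact G hL.exact hL.surj).apply_apply_eq_zero, map_zero]
    rw [lTensor_rTensor_comm] at hn
    obtain ⟨z, hz⟩ := (lTensor_exact E' hL.exact hL.surj _).1 hn
    obtain ⟨k, hk⟩ := h₂ ((φ ^ n).rTensor _ y - f.rTensor _ z) <| by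
      rw [map_sub, ← lTensor_rTensor_comm, ← lTensor_rTensor_comm, hz,
        rTensor_pow_comm hf, hw, sub_self]
    refine ⟨k + n, ?_⟩
    have := congrArg (g.rTensor _) hk
    rw [rTensor_pow_comm hg, map_sub, (rTensor_exact _ h.exact h.surj).apply_apply_eq_zero,
      sub_zero, rTensor_pow_comm hg, map_zero] at this
    rwa [pow_add, Module.End.mul_eq_comp, LinearMap.rTensor_comp_apply]

lemma torVan_succ_of_isSES {f : E' →ₗ[B] G} {g : G →ₗ[B] E} (h : IsSES f g) (i : ℕ)
    (h₁ : TorVan B E' i N) (h₂ : TorVan B G (i + 1) N) : TorVan B E (i + 1) N := by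
  rw [torVan_iff_torTorsion_id] at *
  exact torTorsion_succ_of_isSES h rfl rfl i N h₁ h₂

/-- If multiplication by `φ` is injective on `E` and `Tor` vanishes in the next degree on the
cokernel, `φ`-torsion of `Tor` implies vanishing. -/
lemma torVan_of_torTorsion {φ : E →ₗ[B] E} {g : E →ₗ[B] G} (h : IsSES φ g) (i : ℕ) :
    ∀ (N : Type u) [AddCommGroup N] [Module B N], TorVan B G (i + 1) N →
    TorTorsion B E φ i N → TorVan B E i N := by
  induction i with
  | succ i ih => exact fun N _ _ => ih _
  | zero =>
    intro N _ _ h₁ h₂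
    have hinj : Function.Injective (φ.rTensor (Syz B N)) :=
      rTensor_injective_of_lTensor h.exact h.surj (isSES_syz (B := B) (Syz B N)).exact
        (isSES_syz (B := B) (Syz B N)).surj
        (Module.Flat.rTensor_preserves_injective_linearMap φ h.inj) h₁
    change Function.Injective _
    rw [injective_iff_map_eq_zero]
    intro x hx
    obtain ⟨n, hn⟩ := h₂ x hx
    induction n with
    | zero => simpa [Module.End.one_eq_id] using hn
    | succ n ih =>
      apply ih
      apply hinj
      rwa [map_zero, ← LinearMap.rTensor_comp_apply, ← Module.End.mul_eq_comp, ← pow_succ']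

end TorVanishing

section TorBaseChange

universe u

open TensorProduct

variable {C B : Type u} [CommRing C] [CommRing B] [Algebra C B]
variable {E : Type u} [AddCommGroup E] [Module B E] [Module C E] [IsScalarTower C B E]

lemma lTensor_baseChange_injective_iff {N' F : Type u} [AddCommGroup N'] [Module C N']
    [AddCommGroup F] [Module C F] (f : N' →ₗ[C] F) :
    Function.Injective ((f.baseChange B).lTensor E) ↔ Function.Injective (f.lTensor E) := by
  let e₁ := AlgebraTensorModule.cancelBaseChange C B B E N'
  let e₂ := AlgebraTensorModule.cancelBaseChange C B B E F
  have h : ∀ x, e₂ ((f.baseChange B).lTensor E x) = f.lTensor E (e₁ x) := by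
    intro x
    induction x with
    | zero => simp
    | add x y hx hy => simp only [map_add, hx, hy]
    | tmul a x =>
      induction x with
      | zero => simp
      | add x y hx hy => simp only [map_add, hx, hy, tmul_add]
      | tmul b n => simp [e₁, e₂]
  have h' : e₂ ∘ ((f.baseChange B).lTensor E) = (f.lTensor E) ∘ e₁ := funext h
  rw [← e₂.injective.of_comp_iff, h', Function.Injective.of_comp_iff' _ e₁.bijective]

lemma IsSES.baseChange [Module.Flat C B] {N' F N : Type u} [AddCommGroup N'] [Module C N']
    [AddCommGroup F] [Module C F] [AddCommGroup N] [Module C N] {f : N' →ₗ[C] F} {g : F →ₗ[C] N}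
    (h : IsSES f g) : IsSES (f.baseChange B) (g.baseChange B) where
  inj := Module.Flat.lTensor_preserves_injective_linearMap (M := B) f h.inj
  exact := lTensor_exact B h.exact h.surj
  surj := LinearMap.lTensor_surjective B h.surj

lemma torVan_baseChange_iff [Module.Flat C B] (i : ℕ) : ∀ (N : Type u) [AddCommGroup N]
    [Module C N], TorVan B E i (B ⊗[C] N) ↔ TorVan C E i N := by
  induction i with
  | zero =>
    intro N _ _
    rw [torVan_zero_iff_lTensor (isSES_syz (B := C) N).baseChange]
    exact lTensor_baseChange_injective_iff _
  | succ i ih =>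
    intro N _ _
    rw [torVan_succ_iff_right (isSES_syz (B := C) N).baseChange]
    exact ih _

lemma torVan_quotient_map_iff [Module.Flat C B] (i : ℕ) (I : Ideal C) :
    TorVan B E i (B ⧸ I.map (algebraMap C B)) ↔ TorVan C E i (C ⧸ I) := by
  rw [torVan_congr_right (Ideal.qoutMapEquivTensorQout B)]
  exact torVan_baseChange_iff i _

/-- `TorVanFrom B M t` says that `M` has flat dimension at most `t`. -/
def TorVanFrom (B : Type u) [CommRing B] (M : Type u) [AddCommGroup M] [Module B M] (t : ℕ) :
    Prop :=
  ∀ i, t ≤ i → ∀ (N : Type u) [AddCommGroup N] [Module B N], TorVan B M i N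

lemma TorVanFrom.of_bijective (h : Function.Bijective (algebraMap C B)) {t : ℕ}
    (hE : TorVanFrom C E t) : TorVanFrom B E t := by
  intro i hi N _ _
  let _ : Module C N := Module.compHom N (algebraMap C B)
  have : IsScalarTower C B N := ⟨fun c b n => by
    rw [Algebra.smul_def, mul_smul]; rfl⟩
  have e₀ : C ≃ₗ[C] B := LinearEquiv.ofBijective (Algebra.linearMap C B) h
  have : Module.Flat C B := Module.Flat.of_linearEquiv e₀.symm
  let g : B ⊗[C] N →ₗ[B] N := LinearMap.liftBaseChange B (LinearMap.id : N →ₗ[C] N)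
  have hg : Function.Bijective g := by
    refine ⟨(injective_iff_map_eq_zero _).2 fun x hx => ?_, fun n => ⟨1 ⊗ₜ n, by simp [g]⟩⟩
    have : ∀ x : B ⊗[C] N, x = 1 ⊗ₜ g x := by
      intro x
      induction x with
      | zero => simp
      | add x y hx hy => rw [map_add, tmul_add, ← hx, ← hy]
      | tmul b n =>
        obtain ⟨c, rfl⟩ := h.2 b
        simp only [g, LinearMap.liftBaseChange_tmul, LinearMap.id_apply, algebraMap_smul]
        rw [tmul_smul, smul_tmul', Algebra.smul_def, mul_one]
    rw [this x, hx, tmul_zero]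
  rw [← torVan_congr_right (LinearEquiv.ofBijective g hg), torVan_baseChange_iff]
  exact hE i hi N

end TorBaseChange

section PolynomialExtension

universe u

open TensorProduct

variable {P Q : Type u} [CommRing P] [CommRing Q] [Algebra P Q]
variable {M : Type u} [AddCommGroup M] [Module Q M] [Module P M] [IsScalarTower P Q M]

/-- The map `y ⊗ 1 - 1 ⊗ y` on `Q ⊗ M`. -/
noncomputable def diffMap (P : Type u) [CommRing P] [Algebra P Q] (M : Type u) [AddCommGroup M]
    [Module Q M] [Module P M] [IsScalarTower P Q M] (y : Q) : Q ⊗[P] M →ₗ[Q] Q ⊗[P] M :=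
  y • LinearMap.id - (Algebra.lsmul P P M y).baseChange Q

/-- The partial homotopies `m ↦ ∑_{a + b = i - 1} y ^ a ⊗ y ^ b m`. -/
noncomputable def diffHomotopy (P : Type u) [CommRing P] [Algebra P Q] (M : Type u)
    [AddCommGroup M] [Module Q M] [Module P M] [IsScalarTower P Q M] (y : Q) :
    ℕ → M →ₗ[P] Q ⊗[P] M
  | 0 => 0
  | i + 1 => TensorProduct.mk P Q M (y ^ i) + diffHomotopy P M y i ∘ₗ Algebra.lsmul P P M y

lemma diffMap_tmul (y q : Q) (m : M) : diffMap P M y (q ⊗ₜ m) = (y * q) ⊗ₜ m - q ⊗ₜ (y • m) := by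
  simp [diffMap, smul_tmul']

lemma diffMap_diffHomotopy (y : Q) (i : ℕ) : ∀ m : M,
    diffMap P M y (diffHomotopy P M y i m) = (y ^ i) ⊗ₜ m - 1 ⊗ₜ (y ^ i • m) := by
  induction i with
  | zero => intro m; simp [diffHomotopy]
  | succ i ih =>
    intro m
    simp only [diffHomotopy, LinearMap.add_apply, LinearMap.comp_apply, map_add, ih, mk_apply,
      diffMap_tmul, Algebra.lsmul_coe, smul_smul, ← pow_succ, ← pow_succ']
    abel

lemma isSES_diffMap (y : Q) (b : Module.Basis ℕ P Q) (hb : ∀ i, b i = y ^ i) :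
    IsSES (diffMap P M y) (LinearMap.liftBaseChange Q (LinearMap.id : M →ₗ[P] M)) := by
  let h : Q ⊗[P] M →ₗ[P] Q ⊗[P] M := TensorProduct.lift (b.constr P (diffHomotopy P M y))
  have hh : ∀ i m, h ((y ^ i) ⊗ₜ m) = diffHomotopy P M y i m := by
    intro i m
    simp [h, ← hb]
  have h₁ : h ∘ₗ (diffMap P M y).restrictScalars P = LinearMap.id := by
    apply TensorProduct.ext
    apply b.ext
    intro i
    ext m
    change h (diffMap P M y (b i ⊗ₜ m)) = b i ⊗ₜ m
    rw [hb, diffMap_tmul, map_sub, ← pow_succ', hh, hh]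
    simp [diffHomotopy]
  have h₂ : (diffMap P M y).restrictScalars P ∘ₗ h + TensorProduct.mk P Q M 1 ∘ₗ
      (LinearMap.liftBaseChange Q (LinearMap.id : M →ₗ[P] M)).restrictScalars P = LinearMap.id := by
    apply TensorProduct.ext
    apply b.ext
    intro i
    ext m
    simp [hb, hh, diffMap_diffHomotopy]
  refine ⟨Function.LeftInverse.injective (g := h) fun x => LinearMap.congr_fun h₁ x, ?_,
    fun m => ⟨1 ⊗ₜ m, by simp⟩⟩
  intro x
  constructor
  · intro hx
    have := LinearMap.congr_fun h₂ x
    simp only [LinearMap.add_apply, LinearMap.comp_apply, LinearMap.coe_restrictScalars, hx,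
      map_zero, add_zero, LinearMap.id_apply] at this
    exact ⟨_, this⟩
  · rintro ⟨z, rfl⟩
    induction z with
    | zero => simp
    | add x y hx hy => simp [hx, hy]
    | tmul q m => simp [diffMap_tmul, mul_comm y q, mul_smul]

lemma TorVanFrom.succ_of_basis_pow (y : Q) (b : Module.Basis ℕ P Q) (hb : ∀ i, b i = y ^ i)
    {t : ℕ} (h : TorVanFrom P M t) : TorVanFrom Q M (t + 1) := by
  intro i hi N _ _
  obtain ⟨i, rfl⟩ : ∃ j, i = j + 1 := ⟨i - 1, by omega⟩
  have : Module.Free P Q := Module.Free.of_basis b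
  let _ : Module P N := Module.compHom N (algebraMap P Q)
  have : IsScalarTower P Q N := ⟨fun c b n => by
    rw [Algebra.smul_def, mul_smul]; rfl⟩
  have key : ∀ j, t ≤ j → TorVan Q (Q ⊗[P] M) j N := by
    intro j hj
    rw [torVan_comm, torVan_baseChange_iff, torVan_comm]
    exact h j hj N
  exact torVan_succ_of_isSES (isSES_diffMap y b hb) i (key i (by omega)) (key _ (by omega))

lemma TorVanFrom.of_aeval_bijective (r : ℕ) : ∀ {P Q : Type u} [CommRing P] [CommRing Q]
    [Algebra P Q] {M : Type u} [AddCommGroup M] [Module Q M] [Module P M] [IsScalarTower P Q M]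
    (y : Fin r → Q), Function.Bijective (MvPolynomial.aeval y : MvPolynomial (Fin r) P →ₐ[P] Q) →
    ∀ {t : ℕ}, TorVanFrom P M t → TorVanFrom Q M (t + r) := by
  induction r with
  | zero =>
    intro P Q _ _ _ M _ _ _ _ y hy t h
    refine TorVanFrom.of_bijective (C := P) ?_ h
    have : ⇑(algebraMap P Q) = (MvPolynomial.aeval y : MvPolynomial (Fin 0) P →ₐ[P] Q) ∘
        (MvPolynomial.C) := by
      ext x; simp
    rw [this]
    refine hy.comp ⟨MvPolynomial.C_injective _ _, MvPolynomial.C_surjective _⟩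
  | succ r ih =>
    intro P Q _ _ _ M _ _ _ _ y hy t h
    let P' := MvPolynomial (Fin r) P
    let _ : Algebra P' Q := (MvPolynomial.aeval fun j => y j.succ : P' →ₐ[P] Q).toRingHom.toAlgebra
    let _ : Module P' M := Module.compHom M (algebraMap P' Q)
    have : IsScalarTower P' Q M := ⟨fun c b n => by
      rw [Algebra.smul_def, mul_smul]; rfl⟩
    have : IsScalarTower P P' Q := IsScalarTower.of_algebraMap_eq fun p =>
      (AlgHom.commutes (MvPolynomial.aeval fun j => y j.succ : P' →ₐ[P] Q) p).symm
    have : IsScalarTower P P' M := ⟨fun c b n => by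
      rw [← IsScalarTower.algebraMap_smul Q (c • b) n, ← IsScalarTower.algebraMap_smul Q b n,
        Algebra.smul_def, map_mul, mul_smul, ← IsScalarTower.algebraMap_apply,
        IsScalarTower.algebraMap_smul]⟩
    have h' : TorVanFrom P' M (t + r) := by
      refine ih (Q := P') (MvPolynomial.X) ?_ h
      rw [MvPolynomial.aeval_X_left]
      exact Function.bijective_id
    let e : Polynomial P' →ₗ[P'] Q := (Polynomial.aeval (y 0) : Polynomial P' →ₐ[P'] Q).toLinearMap
    have he : Function.Bijective e := by
      have h1 : (((Polynomial.aeval (y 0) : Polynomial P' →ₐ[P'] Q).restrictScalars P).comp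
          (MvPolynomial.finSuccEquiv P r).toAlgHom) = MvPolynomial.aeval y := by
        apply MvPolynomial.algHom_ext
        intro j
        refine Fin.cases ?_ (fun j => ?_) j
        · simp [MvPolynomial.finSuccEquiv_X_zero]
        · have : (((Polynomial.aeval (y 0) : Polynomial P' →ₐ[P'] Q).restrictScalars P).comp
              (MvPolynomial.finSuccEquiv P r).toAlgHom) (MvPolynomial.X j.succ) =
              Polynomial.aeval (y 0) (MvPolynomial.finSuccEquiv P r (MvPolynomial.X j.succ)) := rfl
          rw [this, MvPolynomial.finSuccEquiv_X_succ, Polynomial.aeval_C, MvPolynomial.aeval_X]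
          exact MvPolynomial.aeval_X (fun j : Fin r => y j.succ) j
      have h2 : (MvPolynomial.aeval y : MvPolynomial (Fin (r + 1)) P →ₐ[P] Q) =
          e ∘ (MvPolynomial.finSuccEquiv P r) := by rw [← h1]; rfl
      rw [h2] at hy
      exact (Function.Bijective.of_comp_iff _ (MvPolynomial.finSuccEquiv P r).bijective).1 hy
    exact h'.succ_of_basis_pow (y 0)
      ((Polynomial.basisMonomials P').map (LinearEquiv.ofBijective e he))
      (fun i => by simp [e])

end PolynomialExtension

section Acyclicity

universe u

open TensorProduct RingTheory.Sequence
open scoped Pointwise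

variable {B S : Type u} [CommRing B] [CommRing S] [Algebra B S]

/-- An acyclicity criterion: torsion of `Tor` along a weakly regular sequence together with a bound
on the flat dimension implies vanishing. -/
lemma torVan_of_isWeaklyRegular {N : Type u} [AddCommGroup N] [Module B N] (rs : List S) :
    ∀ (E : Type u) [AddCommGroup E] [Module S E] [Module B E] [IsScalarTower B S E] (c : ℕ),
    IsWeaklyRegular E rs →
    (∀ i, c ≤ i → ∀ r ∈ rs, TorTorsion B E (Algebra.lsmul B B E r) i N) →
    TorVanFrom B N (c + rs.length) → ∀ i, c ≤ i → TorVan B E i N := by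
  induction rs with
  | nil =>
    intro E _ _ _ _ c _ _ h i hi
    rw [torVan_comm]
    exact h i (by simpa using hi) E
  | cons r rs ih =>
    intro E _ _ _ _ c hreg htor h i hi
    rw [isWeaklyRegular_cons_iff] at hreg
    let g : E →ₗ[B] QuotSMulTop r E := ((r • (⊤ : Submodule S E)).mkQ).restrictScalars B
    have hses : IsSES (Algebra.lsmul B B E r) g := by
      refine ⟨hreg.1, fun x => ?_, (r • (⊤ : Submodule S E)).mkQ_surjective⟩
      change (r • (⊤ : Submodule S E)).mkQ x = 0 ↔ _
      rw [Submodule.mkQ_apply, Submodule.Quotient.mk_eq_zero,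
        Submodule.mem_smul_pointwise_iff_exists]
      simp
    refine torVan_of_torTorsion hses i N ?_ (htor i hi r (by simp))
    refine ih (QuotSMulTop r E) (c + 1) hreg.2 ?_ ?_ (i + 1) (by omega)
    · intro j hj s hs
      obtain ⟨j, rfl⟩ : ∃ l, j = l + 1 := ⟨j - 1, by omega⟩
      refine torTorsion_succ_of_isSES hses (φ' := Algebra.lsmul B B E s)
        (φ := Algebra.lsmul B B E s) ?_ ?_ j N (htor _ (by omega) s (by simp [hs]))
        (htor _ (by omega) s (by simp [hs]))
      · ext x
        simp [smul_smul, mul_comm]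
      · ext x
        rfl
    · rw [List.length_cons, ← add_assoc, add_right_comm] at h
      exact h

lemma torTorsion_of_torVan_away (g : S) (L : Type u) [CommRing L] [Algebra S L] [Algebra B L]
    [IsScalarTower B S L] [IsLocalization.Away g L] (i : ℕ) :
    ∀ (N : Type u) [AddCommGroup N] [Module B N], TorVan B L i N →
    TorTorsion B S (Algebra.lsmul B B S g) i N := by
  induction i with
  | succ i ih => exact fun N _ _ => ih _
  | zero =>
    intro N _ _ h x hx
    let l : S →ₗ[S] L := Algebra.linearMap S L
    have hl : IsLocalizedModule (Submonoid.powers g)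
        (AlgebraTensorModule.rTensor B (Syz B N) l) := inferInstance
    have h0 : AlgebraTensorModule.rTensor B (Syz B N) l x = 0 := by
      change (l.restrictScalars B).rTensor (Syz B N) x = 0
      apply (injective_iff_map_eq_zero _).1 h
      rw [← lTensor_rTensor_comm, hx, map_zero]
    obtain ⟨⟨_, n, rfl⟩, hc⟩ := (IsLocalizedModule.eq_zero_iff (Submonoid.powers g)
      (AlgebraTensorModule.rTensor B (Syz B N) l)).1 h0
    refine ⟨n, ?_⟩
    rw [← hc, ← map_pow]
    clear hc h0 hx
    change _ = g ^ n • x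
    induction x with
    | zero => simp
    | add x y hx hy => rw [map_add, hx, hy, smul_add]
    | tmul s m => rw [LinearMap.rTensor_tmul, Algebra.lsmul_coe, smul_tmul']

end Acyclicity

section Grade

open MvPolynomial RingTheory.Sequence
open scoped Pointwise

lemma height_le_height_comap_of_isIntegral {P Q : Type*} [CommRing P] [CommRing Q] [Algebra P Q]
    [Algebra.IsIntegral P Q] (q : Ideal Q) [hq : q.IsPrime] :
    q.height ≤ (q.comap (algebraMap P Q)).height := by
  have := Order.height_le_height_apply_of_strictMono
    (PrimeSpectrum.comap (algebraMap P Q)) (fun a b hab => by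
      rw [← PrimeSpectrum.asIdeal_lt_asIdeal] at hab ⊢
      exact Ideal.IsIntegral.comap_lt_comap hab) ⟨q, hq⟩
  rwa [← PrimeSpectrum.height_eq_orderHeight, ← PrimeSpectrum.height_eq_orderHeight] at this

lemma le_height_of_monic_mem {P : Type*} [CommRing P] [IsNoetherianRing P]
    {I : Ideal (Polynomial P)} {F : Polynomial P} (hF : F.Monic) (hFI : F ∈ I) {h : ℕ}
    (H : ∀ q : Ideal (Polynomial P), q.IsPrime → I ≤ q → ((h + 1 : ℕ) : ℕ∞) ≤ q.height)
    (p : Ideal P) (hp : p.IsPrime) (hIp : I.comap Polynomial.C ≤ p) : (h : ℕ∞) ≤ p.height := by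
  let Q := Polynomial P ⧸ Ideal.span {F}
  have : Module.Finite P Q := hF.finite_quotient
  obtain ⟨q, hIq, hq, rfl⟩ := Ideal.exists_ideal_over_prime_of_isIntegral (S := Q) p
    (I.map (Ideal.Quotient.mk (Ideal.span {F}))) (by
      refine le_trans (fun x hx => ?_) hIp
      have hx' : Ideal.Quotient.mk (Ideal.span {F}) (Polynomial.C x) ∈
          I.map (Ideal.Quotient.mk (Ideal.span {F})) := hx
      rw [Ideal.mem_comap]
      rwa [Ideal.mem_quotient_iff_mem] at hx'
      rwa [Ideal.span_singleton_le_iff_mem])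
  have h1 := H (q.comap (Ideal.Quotient.mk (Ideal.span {F}))) inferInstance
    (Ideal.map_le_iff_le_comap.1 hIq)
  have hmem : F ∈ q.comap (Ideal.Quotient.mk (Ideal.span {F})) :=
    Ideal.map_le_iff_le_comap.1 hIq hFI
  have h2 := h1.trans (Ideal.height_le_height_add_one_of_mem hmem)
  rw [Ideal.map_comap_of_surjective _ Ideal.Quotient.mk_surjective, Nat.cast_add, Nat.cast_one] at h2
  have h3 : (h : ℕ∞) ≤ q.height := by
    rwa [ENat.add_le_add_iff_right ENat.one_ne_top] at h2
  exact h3.trans (height_le_height_comap_of_isIntegral q)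

lemma isWeaklyRegular_replicate_one {R : Type*} [CommRing R] (h : ℕ) :
    ∀ (M : Type*) [AddCommGroup M] [Module R M], IsWeaklyRegular M (List.replicate h (1 : R)) := by
  induction h with
  | zero => intro M _ _; simp
  | succ h ih =>
    intro M _ _
    rw [List.replicate_succ, isWeaklyRegular_cons_iff]
    exact ⟨IsSMulRegular.one M, ih _⟩

lemma isWeaklyRegular_cons_of_monic {P : Type*} [CommRing P] {F : Polynomial P} (hF : F.Monic)
    {rs : List P} (hrs : IsWeaklyRegular P rs) :
    IsWeaklyRegular (Polynomial P) (F :: rs.map Polynomial.C) := by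
  rw [isWeaklyRegular_cons_iff]
  refine ⟨fun x y hxy => hF.isRegular.left hxy, ?_⟩
  let Q := Polynomial P ⧸ Ideal.span {F}
  have : Module.Free P Q := hF.free_quotient
  have h1 : IsWeaklyRegular Q (rs.map (algebraMap P Q)) := hrs.of_flat
  have h2 : IsWeaklyRegular Q (rs.map Polynomial.C) := by
    rw [isWeaklyRegular_map_algebraMap_iff] at h1
    change IsWeaklyRegular Q (rs.map (algebraMap P (Polynomial P)))
    rwa [isWeaklyRegular_map_algebraMap_iff]
  have h3 : F • (⊤ : Submodule (Polynomial P) (Polynomial P)) = Ideal.span {F} := by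
    rw [← Submodule.ideal_span_singleton_smul, smul_eq_mul, Ideal.mul_top]
  exact ((Submodule.quotEquivOfEq _ _ h3).isWeaklyRegular_congr _).2 h2

section Nagata

variable {k : Type*} [Field k] {n : ℕ}

/-- The substitution `X₀ ↦ X₀`, `Xᵢ ↦ Xᵢ + c X₀ ^ (Nⁱ)` for `i ≠ 0`. -/
noncomputable def nagataHom (n N : ℕ) (c : k) :
    MvPolynomial (Fin (n + 1)) k →ₐ[k] MvPolynomial (Fin (n + 1)) k :=
  aeval fun i => if i = 0 then X 0 else X i + c • X 0 ^ (N ^ i.1)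

lemma nagataHom_comp_neg (N : ℕ) (c : k) :
    (nagataHom n N c).comp (nagataHom n N (-c)) = AlgHom.id _ _ := by
  rw [nagataHom, nagataHom, comp_aeval, ← MvPolynomial.aeval_X_left]
  ext i v
  cases i using Fin.cases <;> simp

/-- The automorphism underlying `nagataHom`. -/
noncomputable def nagataEquiv (k : Type*) [Field k] (n N : ℕ) :
    MvPolynomial (Fin (n + 1)) k ≃ₐ[k] MvPolynomial (Fin (n + 1)) k :=
  AlgEquiv.ofAlgHom (nagataHom n N 1) (nagataHom n N (-1))
    (nagataHom_comp_neg N 1) (by simpa using nagataHom_comp_neg (n := n) N (-1 : k))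

lemma monic_finSuccEquiv_nagataEquiv_monomial {N : ℕ} (hN : N ≠ 0) (v : Fin (n + 1) →₀ ℕ) :
    (finSuccEquiv k n (nagataEquiv k n N (monomial v 1))).Monic ∧
    (finSuccEquiv k n (nagataEquiv k n N (monomial v 1))).natDegree =
      ∑ i : Fin (n + 1), N ^ i.1 * v i := by
  have hX : ∀ i : Fin (n + 1), (finSuccEquiv k n (nagataEquiv k n N (X i))).Monic ∧
      (finSuccEquiv k n (nagataEquiv k n N (X i))).natDegree = N ^ i.1 := by
    intro i
    refine Fin.cases ?_ (fun i => ?_) i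
    · simp [nagataEquiv, nagataHom, finSuccEquiv_X_zero, Polynomial.monic_X]
    · have : finSuccEquiv k n (nagataEquiv k n N (X i.succ)) =
          Polynomial.X ^ N ^ i.succ.1 + Polynomial.C (X i) := by
        simp [nagataEquiv, nagataHom, finSuccEquiv_X_zero, finSuccEquiv_X_succ, Fin.succ_ne_zero,
          add_comm]
      rw [this]
      exact ⟨Polynomial.monic_X_pow_add_C _ (pow_ne_zero _ hN), Polynomial.natDegree_X_pow_add_C⟩
  have hm : finSuccEquiv k n (nagataEquiv k n N (monomial v 1)) =
      ∏ i, (finSuccEquiv k n (nagataEquiv k n N (X i))) ^ v i := by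
    rw [monomial_eq, C_1, one_mul, Finsupp.prod_fintype _ _ (fun i => pow_zero _)]
    simp only [map_prod, map_pow]
  rw [hm]
  refine ⟨Polynomial.monic_prod_of_monic _ _ fun i _ => (hX i).1.pow _, ?_⟩
  rw [Polynomial.natDegree_prod_of_monic _ _ fun i _ => (hX i).1.pow _]
  refine Finset.sum_congr rfl fun i _ => ?_
  rw [(hX i).1.natDegree_pow, (hX i).2, mul_comm]

lemma sum_pow_mul_ne {N : ℕ} (hN : 1 < N) {v w : Fin n →₀ ℕ} (hv : ∀ i, v i < N)
    (hw : ∀ i, w i < N) (hne : v ≠ w) : ∑ x, N ^ x.1 * v x ≠ ∑ x, N ^ x.1 * w x := by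
  intro h
  refine hne <| Finsupp.ext <| congrFun <| List.ofFn_inj.mp ?_
  apply Nat.ofDigits_inj_of_len_eq hN (by simp) (by simpa [List.mem_ofFn] using hv)
    (by simpa [List.mem_ofFn] using hw)
  simpa only [Nat.ofDigits_eq_sum_mapIdx, List.mapIdx_eq_ofFn, List.get_ofFn, List.length_ofFn,
    Fin.val_cast, mul_comm, List.sum_ofFn] using! h

lemma exists_monic_finSuccEquiv (f : MvPolynomial (Fin (n + 1)) k) (hf : f ≠ 0) :
    ∃ (N : ℕ) (c : k), (finSuccEquiv k n (nagataEquiv k n N (c • f))).Monic := by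
  let N := 2 + f.totalDegree
  have hN : N ≠ 0 := by omega
  let T : MvPolynomial (Fin (n + 1)) k →ₐ[k] Polynomial (MvPolynomial (Fin n) k) :=
    ((finSuccEquiv k n).toAlgHom).comp (nagataEquiv k n N).toAlgHom
  let wt : (Fin (n + 1) →₀ ℕ) → ℕ := fun v => ∑ x, N ^ x.1 * v x
  have hmon : ∀ v, (T (monomial v 1)).Monic ∧ (T (monomial v 1)).natDegree = wt v :=
    monic_finSuccEquiv_nagataEquiv_monomial hN
  obtain ⟨v, hv, hmax⟩ := Finset.exists_max_image f.support wt (support_nonempty.mpr hf)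
  have hlt : ∀ w ∈ f.support.erase v, wt w < wt v := fun w hw => by
    refine lt_of_le_of_ne (hmax w (Finset.mem_of_mem_erase hw)) ?_
    have hb : ∀ u ∈ f.support, ∀ i, u i < N := fun u hu i =>
      lt_of_le_of_lt ((monomial_le_degreeOf i hu).trans (degreeOf_le_totalDegree f i)) (by omega)
    exact sum_pow_mul_ne (by omega) (hb w (Finset.mem_of_mem_erase hw)) (hb v hv)
      (Finset.ne_of_mem_erase hw)
  have hc : coeff v f ≠ 0 := mem_support_iff.1 hv
  refine ⟨N, (coeff v f)⁻¹, ?_⟩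
  change (T ((coeff v f)⁻¹ • f)).Monic
  have hsplit : (coeff v f)⁻¹ • f = monomial v 1 +
      ∑ w ∈ f.support.erase v, ((coeff v f)⁻¹ * coeff w f) • monomial w 1 := by
    conv_lhs => rw [f.as_sum, ← Finset.add_sum_erase _ _ hv, smul_add, Finset.smul_sum]
    simp [smul_monomial, hc]
  rw [hsplit, map_add, map_sum]
  refine (hmon v).1.add_of_left ?_
  refine lt_of_le_of_lt (Polynomial.degree_sum_le _ _) ?_
  rw [Finset.sup_lt_iff (by
    rw [Polynomial.degree_eq_natDegree (hmon v).1.ne_zero]; exact WithBot.bot_lt_coe _)]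
  intro w hw
  rw [map_smul]
  refine lt_of_le_of_lt (Polynomial.degree_smul_le _ _) ?_
  refine Polynomial.degree_lt_degree ?_
  rw [(hmon v).2, (hmon w).2]
  exact hlt w hw

end Nagata

lemma exists_isWeaklyRegular_of_ringEquiv {Q P : Type*} [CommRing Q] [CommRing P]
    [IsNoetherianRing P] (e : Q ≃+* Polynomial P) {I : Ideal Q} {g : Q} (hgI : g ∈ I)
    (hg : (e g).Monic) {h : ℕ}
    (H : ∀ p : Ideal Q, p.IsPrime → I ≤ p → ((h + 1 : ℕ) : ℕ∞) ≤ p.height)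
    (ih : ∀ I' : Ideal P, (∀ p : Ideal P, p.IsPrime → I' ≤ p → (h : ℕ∞) ≤ p.height) →
      ∃ rs : List P, rs.length = h ∧ (∀ r ∈ rs, r ∈ I') ∧ IsWeaklyRegular P rs) :
    ∃ rs : List Q, rs.length = h + 1 ∧ (∀ r ∈ rs, r ∈ I) ∧ IsWeaklyRegular Q rs := by
  have hgI' : e g ∈ I.comap (e.symm : Polynomial P →+* Q) := by
    rw [Ideal.mem_comap]
    simpa using hgI
  obtain ⟨rs, hlen, hmem, hreg⟩ := ih ((I.comap (e.symm : Polynomial P →+* Q)).comap Polynomial.C)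
    (le_height_of_monic_mem hg hgI' fun q hq hIq => by
      have h1 := H (q.comap (e : Q →+* Polynomial P)) inferInstance (fun x hx => hIq (by
        rw [Ideal.mem_comap]; simpa using hx))
      exact h1.trans (le_of_eq (RingEquiv.height_comap e q)))
  refine ⟨(e g :: rs.map Polynomial.C).map e.symm, by simp [hlen], ?_, ?_⟩
  · intro r hr
    simp only [List.map_cons, List.mem_cons, List.mem_map] at hr
    rcases hr with rfl | ⟨_, ⟨a, ha, rfl⟩, rfl⟩
    · exact hgI'
    · exact hmem a ha
  · refine (AddEquiv.isWeaklyRegular_congr (e := e.symm.toAddEquiv) ?_).1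
      (isWeaklyRegular_cons_of_monic hg hreg)
    rw [List.forall₂_map_right_iff]
    exact List.forall₂_same.2 fun r _ x => by simp

lemma exists_isWeaklyRegular_of_le_height {K : Type*} [Field K] (n : ℕ) :
    ∀ (h : ℕ) (I : Ideal (MvPolynomial (Fin n) K)),
    (∀ p : Ideal (MvPolynomial (Fin n) K), p.IsPrime → I ≤ p → (h : ℕ∞) ≤ p.height) →
    ∃ rs : List (MvPolynomial (Fin n) K), rs.length = h ∧ (∀ r ∈ rs, r ∈ I) ∧
      IsWeaklyRegular (MvPolynomial (Fin n) K) rs := by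
  induction n with
  | zero =>
    intro h I H
    rcases Nat.eq_zero_or_pos h with rfl | hh
    · exact ⟨[], by simp⟩
    by_cases hI : I = ⊤
    · exact ⟨List.replicate h 1, by simp, by simp [hI], isWeaklyRegular_replicate_one _ _⟩
    exfalso
    obtain ⟨f, hfI, hf⟩ : ∃ f ∈ I, f ≠ 0 := by
      by_contra! hcon
      have := H ⊥ Ideal.isPrime_bot (fun x hx => hcon x hx)
      simp at this
      omega
    refine hI (Ideal.eq_top_of_isUnit_mem _ hfI ?_)
    have := (isEmptyAlgEquiv K (Fin 0))
    rw [← MulEquiv.isUnit_map this]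
    exact isUnit_iff_ne_zero.2 (by simpa using hf)
  | succ n ih =>
    intro h I H
    rcases h with _ | h
    · exact ⟨[], by simp⟩
    by_cases hI : I = ⊤
    · exact ⟨List.replicate (h + 1) 1, by simp, by simp [hI], isWeaklyRegular_replicate_one _ _⟩
    obtain ⟨f, hfI, hf⟩ : ∃ f ∈ I, f ≠ 0 := by
      by_contra! hcon
      have := H ⊥ Ideal.isPrime_bot (fun x hx => hcon x hx)
      simp at this
    obtain ⟨N, c, hF⟩ := exists_monic_finSuccEquiv f hf
    exact exists_isWeaklyRegular_of_ringEquiv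
      ((nagataEquiv K n N).trans (finSuccEquiv K n)).toRingEquiv
      (Submodule.smul_of_tower_mem I c hfI) hF H (ih h)

end Grade

section Brackets

/-- The maximal minor of `X` on the columns `d`. -/
def bracket {S : Type*} [CommRing S] {m n : ℕ} (X : Matrix (Fin m) (Fin n) S)
    (d : Fin m → Fin n) : S :=
  (X.submatrix id d).det

variable {S : Type*} [CommRing S] {m n : ℕ} (X : Matrix (Fin m) (Fin n) S)

/-- The determinant of a matrix, as an alternating function of the rows indexed by `p`. -/
def partialDet (p : Fin m → Prop) [DecidablePred p] (z : Fin m → Fin m → S) :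
    (Fin m → S) [⋀^{i // p i}]→ₗ[S] S where
  toFun v := Matrix.det (Matrix.of fun i => if h : p i then v ⟨i, h⟩ else z i)
  map_update_add' v i x y := by
    have key : ∀ w : Fin m → S,
        (Matrix.of fun j => if h : p j then Function.update v i w ⟨j, h⟩ else z j) =
        Matrix.updateRow (Matrix.of fun j => if h : p j then v ⟨j, h⟩ else z j) i.1 w := by
      intro w
      ext j l
      by_cases hj : j = i.1
      · subst hj; simp [i.2]
      · have : ∀ h : p j, (⟨j, h⟩ : {i // p i}) ≠ i := fun h e => hj (congrArg Subtype.val e)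
        by_cases h : p j <;> simp [Matrix.updateRow_ne hj, h, this]
    rw [key, key, key, Matrix.det_updateRow_add]
  map_update_smul' v i c x := by
    have key : ∀ w : Fin m → S,
        (Matrix.of fun j => if h : p j then Function.update v i w ⟨j, h⟩ else z j) =
        Matrix.updateRow (Matrix.of fun j => if h : p j then v ⟨j, h⟩ else z j) i.1 w := by
      intro w
      ext j l
      by_cases hj : j = i.1
      · subst hj; simp [i.2]
      · have : ∀ h : p j, (⟨j, h⟩ : {i // p i}) ≠ i := fun h e => hj (congrArg Subtype.val e)
        by_cases h : p j <;> simp [Matrix.updateRow_ne hj, h, this]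
    rw [key, key, Matrix.det_updateRow_smul, smul_eq_mul]
  map_eq_zero_of_eq' v i j hv hij := by
    refine Matrix.det_zero_of_row_eq (i := i.1) (j := j.1) (fun h => hij (Subtype.ext h)) ?_
    funext l
    simp [i.2, j.2, hv]

lemma partialDet_col (p : Fin m → Prop) [DecidablePred p] (a : Fin m → Fin n)
    (u : {i // p i} → Fin n) :
    partialDet p (fun i => X.col (a i)) (fun i => X.col (u i)) =
      bracket X (fun i => if h : p i then u ⟨i, h⟩ else a i) := by
  rw [bracket, ← Matrix.det_transpose]
  change Matrix.det _ = _
  congr 1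
  ext i j
  by_cases h : p i <;> simp [h, Matrix.col]

lemma sum_comp_perm_inl_lt {α β : Type*} [Fintype α] [Fintype β] (σ : Equiv.Perm (α ⊕ β))
    (u : α ⊕ β → ℕ) (c : ℕ) (hα : ∀ x, c ≤ u (.inl x)) (hβ : ∀ y, u (.inr y) < c)
    (hσ : ∃ x y, σ (.inl x) = .inr y) :
    ∑ x, u (σ (.inl x)) < ∑ x, u (.inl x) := by
  classical
  let f : α ⊕ β → ℤ := fun z => (u z : ℤ) - c
  have h1 : ∑ x, f (σ (.inl x)) < ∑ x, f (.inl x) := by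
    let g : α ⊕ β → ℤ := fun z => max (f z) 0
    have hfg : ∀ z, f z ≤ g z := fun z => le_max_left _ _
    have hg0 : ∀ y, g (.inr y) = 0 := fun y => by
      have := hβ y; simp only [g, f]; omega
    have hgl : ∀ x, g (.inl x) = f (.inl x) := fun x => by
      have := hα x; simp only [g, f]; omega
    have e1 : ∑ x, g (σ (.inl x)) + ∑ y, g (σ (.inr y)) = ∑ x, f (.inl x) := by
      rw [← Fintype.sum_sum_type (fun z => g (σ z)), Equiv.sum_comp σ g, Fintype.sum_sum_type]
      simp [hg0, hgl]
    have e2 : 0 ≤ ∑ y, g (σ (.inr y)) := Finset.sum_nonneg fun y _ => le_max_right _ _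
    have e3 : ∑ x, f (σ (.inl x)) < ∑ x, g (σ (.inl x)) := by
      obtain ⟨x, y, hxy⟩ := hσ
      refine Finset.sum_lt_sum (fun x _ => hfg _) ⟨x, Finset.mem_univ _, ?_⟩
      rw [hxy, hg0]
      have := hβ y; simp only [f]; omega
    omega
  simp only [f, Finset.sum_sub_distrib] at h1
  have h2 : (∑ x, (u (σ (.inl x)) : ℤ)) < ∑ x, (u (.inl x) : ℤ) := by linarith
  exact_mod_cast h2

lemma sum_dite_val (p : Fin m → Prop) [DecidablePred p] (a : Fin m → Fin n)
    (u : {i // p i} → Fin n) :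
    ∑ i, (if h : p i then u ⟨i, h⟩ else a i).val =
      ∑ x, (u x).val + ∑ x : {i // ¬ p i}, (a x.1).val := by
  rw [← Fintype.sum_subtype_add_sum_subtype p]
  congr 1
  · exact Finset.sum_congr rfl fun x _ => by simp [x.2]
  · exact Finset.sum_congr rfl fun x _ => by simp [x.2]

lemma bracket_mul_bracket_mem (a b : Fin m → Fin n) (s : Fin m)
    (ha : Monotone a) (hb : Monotone b) (hs : b s < a s) :
    bracket X a * bracket X b ∈ AddSubgroup.closure {z : S | ∃ a' b' : Fin m → Fin n,
      z = bracket X a' * bracket X b' ∧ ∑ i, (a' i).val < ∑ i, (a i).val ∧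
      ∑ i, (a' i).val + ∑ i, (b' i).val = ∑ i, (a i).val + ∑ i, (b i).val} := by
  let f := partialDet (fun i => s ≤ i) (fun i => X.col (a i))
  let g := partialDet (fun i => i ≤ s) (fun i => X.col (b i))
  have hzero : f.domCoprod g = 0 := by
    refine Module.Basis.ext_alternating (Pi.basisFun S (Fin m)) fun v hv => ?_
    exfalso
    have h1 := Fintype.card_le_of_injective v hv
    rw [Fintype.card_sum, Fintype.card_fin, Fintype.card_subtype, Fintype.card_subtype] at h1
    have h2 : Finset.univ.filter (fun i : Fin m => s ≤ i) ∪ Finset.univ.filter (· ≤ s) =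
        Finset.univ := by ext i; simpa using le_total s i
    have h3 : (Finset.univ.filter (fun i : Fin m => s ≤ i) ∩
        Finset.univ.filter (· ≤ s)) = {s} := by
      ext i; simp [le_antisymm_iff, and_comm]
    have h4 := Finset.card_union_add_card_inter (Finset.univ.filter (fun i : Fin m => s ≤ i))
      (Finset.univ.filter (· ≤ s))
    rw [h2, h3] at h4
    simp at h4
    omega
  let u : {i // s ≤ i} ⊕ {i // i ≤ s} → Fin n := Sum.elim (fun i => a i.1) (fun i => b i.1)
  let T : Equiv.Perm.ModSumCongr {i // s ≤ i} {i // i ≤ s} → S := fun σ =>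
    LinearMap.mul' S S (AlternatingMap.domCoprod.summand f g σ (fun z => X.col (u z)))
  have hsum : ∑ σ, T σ = 0 := by
    have := congrArg (LinearMap.mul' S S) (DFunLike.congr_fun hzero (fun z => X.col (u z)))
    rw [AlternatingMap.domCoprod_apply] at this
    simpa [T, _root_.sum_apply] using this
  have hT : ∀ σ : Equiv.Perm ({i // s ≤ i} ⊕ {i // i ≤ s}),
      T (Quotient.mk'' σ) = Equiv.Perm.sign σ •
        (bracket X (fun i => if h : s ≤ i then u (σ (.inl ⟨i, h⟩)) else a i) *
          bracket X (fun i => if h : i ≤ s then u (σ (.inr ⟨i, h⟩)) else b i)) := by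
    intro σ
    simp only [T]
    rw [AlternatingMap.domCoprod.summand_mk'']
    simp only [_root_.smul_apply, MultilinearMap.domDomCongr_apply,
      MultilinearMap.domCoprod_apply]
    rw [Units.smul_def, Units.smul_def, map_zsmul]
    congr 1
    rw [LinearMap.mul'_apply]
    congr 1
    · exact partialDet_col X _ a (fun i => u (σ (.inl i)))
    · exact partialDet_col X _ b (fun i => u (σ (.inr i)))
  have hT1 : T (Quotient.mk'' 1) = bracket X a * bracket X b := by
    rw [hT]
    simp [u]
  have hsplit := Finset.add_sum_erase Finset.univ T (Finset.mem_univ (Quotient.mk'' 1))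
  rw [hsum, hT1] at hsplit
  rw [eq_neg_of_add_eq_zero_left hsplit]
  refine neg_mem (sum_mem fun σ hσ => ?_)
  have hne : σ ≠ Quotient.mk'' 1 := Finset.ne_of_mem_erase hσ
  clear hσ
  induction σ using Quotient.inductionOn' with | _ σ
  rw [hT]
  have hex : ∃ x y, σ (.inl x) = .inr y := by
    by_contra! hcon
    refine hne (Quotient.sound' ?_)
    rw [QuotientGroup.leftRel_apply, mul_one, inv_mem_iff]
    refine Equiv.Perm.mem_sumCongrHom_range_of_perm_mapsTo_inl ?_
    rintro _ ⟨x, rfl⟩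
    rcases h : σ (.inl x) with y | y
    · exact ⟨y, rfl⟩
    · exact absurd h (hcon x y)
  have hlt := sum_comp_perm_inl_lt σ (fun z => (u z).val) (b s + 1)
    (fun x => lt_of_lt_of_le hs (ha x.2)) (fun y => Nat.lt_succ_of_le (hb y.2)) hex
  have hmem : bracket X (fun i => if h : s ≤ i then u (σ (.inl ⟨i, h⟩)) else a i) *
      bracket X (fun i => if h : i ≤ s then u (σ (.inr ⟨i, h⟩)) else b i) ∈
      AddSubgroup.closure {z : S | ∃ a' b' : Fin m → Fin n,
      z = bracket X a' * bracket X b' ∧ ∑ i, (a' i).val < ∑ i, (a i).val ∧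
      ∑ i, (a' i).val + ∑ i, (b' i).val = ∑ i, (a i).val + ∑ i, (b i).val} := by
    have ea := sum_dite_val (fun i => s ≤ i) a (fun x => u (σ (.inl x)))
    have eb := sum_dite_val (fun i => i ≤ s) b (fun x => u (σ (.inr x)))
    have ea' := sum_dite_val (fun i => s ≤ i) a (fun x => u (.inl x))
    have eb' := sum_dite_val (fun i => i ≤ s) b (fun x => u (.inr x))
    have hperm := Equiv.sum_comp σ (fun z => (u z).val)
    rw [Fintype.sum_sum_type, Fintype.sum_sum_type] at hperm
    simp only [u, Sum.elim_inl, Sum.elim_inr, dite_eq_ite, ite_self] at ea' eb'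
    simp only [u, Sum.elim_inl, Sum.elim_inr] at hperm hlt
    refine AddSubgroup.subset_closure ⟨_, _, rfl, ?_, ?_⟩
    · rw [ea, ea']
      exact Nat.add_lt_add_right hlt _
    · rw [ea, ea', eb, eb']
      simp only [u]
      omega
  rcases Int.units_eq_one_or (Equiv.Perm.sign σ) with h | h <;> rw [h] <;> simpa using hmem

end Brackets

section Straightening

variable {S : Type*} [CommRing S] {m n k : ℕ} (X : Matrix (Fin m) (Fin n) S)

/-- A product of maximal minors. -/
def bracketProd (D : Fin k → Fin m → Fin n) : S := ∏ t, bracket X (D t)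

/-- A tableau is standard if its rows are strictly increasing and its columns are weakly
increasing. -/
def IsStandard (D : Fin k → Fin m → Fin n) : Prop := (∀ t, StrictMono (D t)) ∧ Monotone D

lemma bracket_eq_zero_of_not_injective {d : Fin m → Fin n} (hd : ¬ Function.Injective d) :
    bracket X d = 0 := by
  simp only [Function.Injective, not_forall] at hd
  obtain ⟨i, j, hij, hne⟩ := hd
  exact Matrix.det_zero_of_column_eq hne fun l => by simp [hij]

lemma exists_strictMono_bracket {d : Fin m → Fin n} (hd : Function.Injective d) :
    ∃ d' : Fin m → Fin n, StrictMono d' ∧ ∑ i, (d' i).val = ∑ i, (d i).val ∧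
      (bracket X d = bracket X d' ∨ bracket X d = - bracket X d') := by
  refine ⟨d ∘ Tuple.sort d, (Tuple.monotone_sort d).strictMono_of_injective
    (hd.comp (Tuple.sort d).injective), Equiv.sum_comp (Tuple.sort d) (fun i => (d i).val), ?_⟩
  have h := Matrix.det_permute' (Tuple.sort d) (X.submatrix id d)
  rw [Matrix.submatrix_submatrix, Function.comp_id] at h
  change bracket X (d ∘ Tuple.sort d) = _ * bracket X d at h
  rw [h]
  rcases Int.units_eq_one_or (Equiv.Perm.sign (Tuple.sort d)) with h | h <;> rw [h] <;> simp

lemma prod_eq_or_eq_neg {ι : Type*} (s : Finset ι) (f g : ι → S)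
    (h : ∀ i, f i = g i ∨ f i = - g i) :
    ∏ i ∈ s, f i = ∏ i ∈ s, g i ∨ ∏ i ∈ s, f i = - ∏ i ∈ s, g i := by
  classical
  induction s using Finset.induction_on with
  | empty => simp
  | insert a s ha ih =>
    rw [Finset.prod_insert ha, Finset.prod_insert ha]
    rcases h a with h | h <;> rcases ih with ih | ih <;> simp [h, ih]

lemma bracketProd_mem_closure_isStandard (D : Fin k → Fin m → Fin n) :
    bracketProd X D ∈ AddSubgroup.closure {z : S | ∃ C : Fin k → Fin m → Fin n,
      IsStandard C ∧ z = bracketProd X C} := by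
  suffices H : ∀ (N : ℕ) (D : Fin k → Fin m → Fin n),
      ∑ t, (k - t.val) * ∑ i, (D t i).val = N → bracketProd X D ∈
      AddSubgroup.closure {z : S | ∃ C : Fin k → Fin m → Fin n,
      IsStandard C ∧ z = bracketProd X C} from H _ D rfl
  intro N
  induction N using Nat.strong_induction_on with | _ N ih
  suffices H : ∀ D : Fin k → Fin m → Fin n, (∀ t, StrictMono (D t)) →
      ∑ t, (k - t.val) * ∑ i, (D t i).val = N → bracketProd X D ∈
      AddSubgroup.closure {z : S | ∃ C : Fin k → Fin m → Fin n,
      IsStandard C ∧ z = bracketProd X C} by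
    intro D hD
    by_cases hinj : ∀ t, Function.Injective (D t)
    · choose D' hD' hsum hbr using fun t => exists_strictMono_bracket X (hinj t)
      have h1 := H D' hD' (by simp only [hsum, hD])
      have h2 : bracketProd X D = bracketProd X D' ∨ bracketProd X D = - bracketProd X D' :=
        prod_eq_or_eq_neg _ _ _ hbr
      rcases h2 with h2 | h2 <;> rw [h2]
      · exact h1
      · exact neg_mem h1
    · push Not at hinj
      obtain ⟨t, ht⟩ := hinj
      rw [bracketProd, Finset.prod_eq_zero (Finset.mem_univ t)
        (bracket_eq_zero_of_not_injective X ht)]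
      exact zero_mem _
  intro D hstrict hN
  by_cases hmono : Monotone D
  · exact AddSubgroup.subset_closure ⟨D, ⟨hstrict, hmono⟩, rfl⟩
  simp only [Monotone, not_forall] at hmono
  obtain ⟨t₀, t₁, hle, hnot⟩ := hmono
  have hne : t₀ ≠ t₁ := by rintro rfl; exact hnot le_rfl
  have hlt : t₀ < t₁ := lt_of_le_of_ne hle hne
  simp only [Pi.le_def, not_forall, not_le] at hnot
  obtain ⟨s, hs⟩ := hnot
  have hmem := bracket_mul_bracket_mem X (D t₀) (D t₁) s (hstrict t₀).monotone
    (hstrict t₁).monotone hs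
  have hsplit : ∀ D : Fin k → Fin m → Fin n, bracketProd X D = bracket X (D t₀) *
      bracket X (D t₁) * ∏ t ∈ (Finset.univ.erase t₀).erase t₁, bracket X (D t) := fun D => by
    rw [bracketProd, mul_assoc, Finset.mul_prod_erase _ (fun t => bracket X (D t))
      (by simp [hne.symm]), Finset.mul_prod_erase _ (fun t => bracket X (D t)) (by simp)]
  have hsplit' : ∀ f : Fin k → ℕ,
      ∑ t, f t = f t₀ + f t₁ + ∑ t ∈ (Finset.univ.erase t₀).erase t₁, f t := fun f => by
    rw [add_assoc, Finset.add_sum_erase _ _ (by simp [hne.symm]),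
      Finset.add_sum_erase _ _ (by simp)]
  rw [hsplit]
  generalize bracket X (D t₀) * bracket X (D t₁) = z at hmem
  induction hmem using AddSubgroup.closure_induction with
  | zero => rw [zero_mul]; exact zero_mem _
  | add x y _ _ hx hy => rw [add_mul]; exact add_mem hx hy
  | neg x _ hx => rw [neg_mul]; exact neg_mem hx
  | mem x hx =>
    obtain ⟨a, b, rfl, hlt', hsum⟩ := hx
    let D' := Function.update (Function.update D t₀ a) t₁ b
    have h0 : D' t₀ = a := by simp [D', hne]
    have h1 : D' t₁ = b := by simp [D']
    have hother : ∀ t ∈ (Finset.univ.erase t₀).erase t₁, D' t = D t := fun t ht => by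
      simp only [Finset.mem_erase] at ht
      simp [D', ht.1, ht.2.1]
    have hD' : bracketProd X D' = bracket X a * bracket X b *
        ∏ t ∈ (Finset.univ.erase t₀).erase t₁, bracket X (D t) := by
      rw [hsplit, h0, h1]
      congr 1
      exact Finset.prod_congr rfl fun t ht => by rw [hother t ht]
    rw [← hD']
    refine ih _ ?_ D' rfl
    have hrest : ∑ t ∈ (Finset.univ.erase t₀).erase t₁, (k - t.val) * ∑ i, (D' t i).val =
        ∑ t ∈ (Finset.univ.erase t₀).erase t₁, (k - t.val) * ∑ i, (D t i).val :=
      Finset.sum_congr rfl fun t ht => by rw [hother t ht]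
    rw [← hN, hsplit', hsplit', h0, h1, hrest]
    refine Nat.add_lt_add_right ?_ _
    obtain ⟨c, hc⟩ : ∃ c, k - t₀.val = (k - t₁.val) + (c + 1) :=
      ⟨t₁.val - t₀.val - 1, by have := t₁.2; have : t₀.val < t₁.val := hlt; omega⟩
    rw [hc, add_mul, add_mul _ _ (∑ i, (D t₀ i).val), add_right_comm, ← mul_add, hsum,
      add_right_comm ((k - t₁.val) * _), ← mul_add]
    exact Nat.add_lt_add_left (Nat.mul_lt_mul_of_pos_left hlt' (Nat.succ_pos c)) _

end Straightening

section Leading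

open MvPolynomial

variable {K : Type*} [CommRing K] {σ : Type*} (wt : (σ →₀ ℕ) →+ ℕ)

/-- `f` is the monomial of exponent `ρ` plus terms of smaller weight. -/
def IsLead (f : MvPolynomial σ K) (ρ : σ →₀ ℕ) : Prop :=
  coeff ρ f = 1 ∧ ∀ τ, τ ≠ ρ → wt ρ ≤ wt τ → coeff τ f = 0

variable {wt}

lemma IsLead.mul {f g : MvPolynomial σ K} {ρ τ : σ →₀ ℕ} (hf : IsLead wt f ρ)
    (hg : IsLead wt g τ) : IsLead wt (f * g) (ρ + τ) := by
  classical
  have key : ∀ κ, wt (ρ + τ) ≤ wt κ → ∀ x ∈ Finset.HasAntidiagonal.antidiagonal κ, x ≠ (ρ, τ) →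
      coeff x.1 f * coeff x.2 g = 0 := by
    intro κ hκ x hx hne
    rw [Finset.HasAntidiagonal.mem_antidiagonal] at hx
    rw [← hx, map_add, map_add] at hκ
    by_cases h1 : wt ρ ≤ wt x.1
    · by_cases h2 : x.1 = ρ
      · have h3 : x.2 ≠ τ := fun h => hne (Prod.ext h2 h)
        rw [h2] at hκ
        rw [hg.2 _ h3 (by omega), mul_zero]
      · rw [hf.2 _ h2 h1, zero_mul]
    · have h3 : x.2 ≠ τ := fun h => by rw [h] at hκ; omega
      rw [hg.2 _ h3 (by omega), mul_zero]
  constructor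
  · rw [coeff_mul, Finset.sum_eq_single (ρ, τ) (key _ le_rfl) (by simp), hf.1, hg.1, one_mul]
  · intro κ hne hκ
    rw [coeff_mul]
    refine Finset.sum_eq_zero fun x hx => key κ hκ x hx ?_
    rintro rfl
    exact hne (Finset.HasAntidiagonal.mem_antidiagonal.1 hx).symm

variable (wt) in
lemma isLead_monomial (ρ : σ →₀ ℕ) : IsLead wt (monomial ρ (1 : K)) ρ := by
  classical
  exact ⟨by simp, fun τ h _ => by simp [coeff_monomial, h.symm]⟩

lemma isLead_prod {ι : Type*} (s : Finset ι) {f : ι → MvPolynomial σ K} {ρ : ι → σ →₀ ℕ}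
    (h : ∀ i ∈ s, IsLead wt (f i) (ρ i)) : IsLead wt (∏ i ∈ s, f i) (∑ i ∈ s, ρ i) := by
  classical
  induction s using Finset.induction_on with
  | empty => simpa using isLead_monomial wt (K := K) 0
  | insert a s ha ih =>
    rw [Finset.prod_insert ha, Finset.sum_insert ha]
    exact (h a (by simp)).mul (ih fun i hi => h i (by simp [hi]))

lemma exists_isLead_sub_mem_span [Nontrivial K] {ι : Type*} {E : ι → MvPolynomial σ K}
    {lead : ι → σ →₀ ℕ} (T : Set ι) (hE : ∀ i ∈ T, IsLead wt (E i) (lead i))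
    (hT : Set.InjOn lead T) {f : MvPolynomial σ K} {ρ : σ →₀ ℕ} (hf : IsLead wt f ρ)
    (hmem : f ∈ Submodule.span K (E '' T)) :
    ∃ c ∈ T, lead c = ρ ∧
      f - E c ∈ Submodule.span K (E '' {c' ∈ T | wt (lead c') < wt ρ}) := by
  classical
  obtain ⟨a, haT, ha⟩ := (Finsupp.mem_span_image_iff_linearCombination K).1 hmem
  rw [Finsupp.mem_supported] at haT
  have hsum : ∀ τ, coeff τ f = ∑ i ∈ a.support, a i * coeff τ (E i) := fun τ => by
    rw [← ha, Finsupp.linearCombination_apply, Finsupp.sum, coeff_sum]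
    simp
  have hcoeff : ∀ c ∈ a.support, (∀ c' ∈ a.support, wt (lead c') ≤ wt (lead c)) →
      coeff (lead c) f = a c := by
    intro c hc hmax
    rw [hsum, Finset.sum_eq_single c]
    · rw [(hE c (haT hc)).1, mul_one]
    · intro c' hc' hne
      rw [(hE c' (haT hc')).2 _ (fun h => hne (hT (haT hc') (haT hc) h.symm)) (hmax c' hc'),
        mul_zero]
    · exact fun h => absurd hc h
  have hle : ∀ c ∈ a.support, wt (lead c) ≤ wt ρ := by
    by_contra! hcon
    obtain ⟨c₀, hc₀, hlt₀⟩ := hcon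
    obtain ⟨c, hc, hmax⟩ := Finset.exists_max_image a.support (fun c => wt (lead c)) ⟨c₀, hc₀⟩
    have hlt : wt ρ < wt (lead c) := lt_of_lt_of_le hlt₀ (hmax c₀ hc₀)
    have h1 := hcoeff c hc hmax
    rw [hf.2 _ (fun h => by rw [h] at hlt; exact lt_irrefl _ hlt) hlt.le] at h1
    exact Finsupp.mem_support_iff.1 hc h1.symm
  have htop : ∀ c ∈ a.support, wt (lead c) = wt ρ → lead c = ρ ∧ a c = 1 := by
    intro c hc heq
    have h1 := hcoeff c hc (fun c' hc' => (hle c' hc').trans heq.ge)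
    by_cases h : lead c = ρ
    · rw [h, hf.1] at h1
      exact ⟨h, h1.symm⟩
    · rw [hf.2 _ h heq.ge] at h1
      exact absurd h1.symm (Finsupp.mem_support_iff.1 hc)
  obtain ⟨c, hc, hcρ⟩ : ∃ c ∈ a.support, lead c = ρ := by
    by_contra! hcon
    have h0 := hsum ρ
    rw [hf.1, Finset.sum_eq_zero] at h0
    · exact one_ne_zero h0
    · intro c hc
      rw [(hE c (haT hc)).2 ρ (hcon c hc).symm (hle c hc), mul_zero]
  refine ⟨c, haT hc, hcρ, ?_⟩
  have hac : a c = 1 := (htop c hc (by rw [hcρ])).2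
  have hsub : f - E c = ∑ i ∈ a.support.erase c, a i • E i := by
    rw [sub_eq_iff_eq_add', ← ha, Finsupp.linearCombination_apply, Finsupp.sum,
      ← Finset.add_sum_erase _ _ hc, hac, one_smul]
  rw [hsub]
  refine Submodule.sum_mem _ fun i hi => Submodule.smul_mem _ _ (Submodule.subset_span ⟨i, ?_, rfl⟩)
  have hi' := Finset.mem_of_mem_erase hi
  refine ⟨haT hi', lt_of_le_of_ne (hle i hi') fun h => ?_⟩
  exact Finset.ne_of_mem_erase hi (hT (haT hi') (haT hc) ((htop i hi' h).1.trans hcρ.symm))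

end Leading

section Cells

open MvPolynomial

variable {m n k : ℕ}

/-- The weight of the variable in position `(i, j)` is `i * j`. -/
noncomputable def cellWt (m n : ℕ) : (Fin m × Fin n →₀ ℕ) →+ ℕ :=
  (Finsupp.weight fun p : Fin m × Fin n => p.1.val * p.2.val)

/-- The exponent of the diagonal monomial of the minor with columns `d`. -/
noncomputable def rowExp (d : Fin m → Fin n) : Fin m × Fin n →₀ ℕ :=
  ∑ i, Finsupp.single (i, d i) 1

/-- The exponent of the product of the diagonal monomials of a tableau. -/
noncomputable def tabExp (D : Fin k → Fin m → Fin n) : Fin m × Fin n →₀ ℕ := ∑ t, rowExp (D t)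

/-- The generic matrix. -/
noncomputable def genMat (K : Type*) [CommRing K] (m n : ℕ) :
    Matrix (Fin m) (Fin n) (MvPolynomial (Fin m × Fin n) K) :=
  Matrix.of fun i j => MvPolynomial.X (i, j)

variable (K : Type*) [CommRing K]

lemma cellWt_sum_single (r : Fin m → Fin m) (d : Fin m → Fin n) :
    cellWt m n (∑ i, Finsupp.single (r i, d i) 1) = ∑ i, (r i).val * (d i).val := by
  simp [cellWt, Finsupp.weight_single]

lemma isLead_bracket {d : Fin m → Fin n} (hd : StrictMono d) :
    IsLead (cellWt m n) (bracket (genMat K m n) d) (rowExp d) := by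
  classical
  have hdet : bracket (genMat K m n) d = ∑ π : Equiv.Perm (Fin m), (Equiv.Perm.sign π) •
      monomial (∑ i, Finsupp.single (π i, d i) 1) (1 : K) := by
    rw [bracket, Matrix.det_apply]
    refine Finset.sum_congr rfl fun π _ => ?_
    congr 1
    exact (monomial_sum_one _ _).symm
  have hwt : ∀ π : Equiv.Perm (Fin m), π ≠ 1 →
      cellWt m n (∑ i, Finsupp.single (π i, d i) 1) < cellWt m n (rowExp d) := by
    intro π hπ
    rw [rowExp, cellWt_sum_single, cellWt_sum_single (fun i => i)]
    have hmv : Monovary (fun i : Fin m => i.val) (fun i => (d i).val) := by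
      intro i j hij
      exact (hd.lt_iff_lt.1 hij).le
    rw [hmv.sum_comp_perm_mul_lt_sum_mul_iff (σ := π)]
    intro hcon
    apply hπ
    have hmono : Monotone π := by
      intro i j hij
      rcases hij.lt_or_eq with h | h
      · exact hcon (i := i) (j := j) (hd h)
      · rw [h]
    have hstrict := hmono.strictMono_of_injective π.injective
    exact Equiv.ext fun i => congrFun (le_antisymm hstrict.le_id hstrict.id_le) i
  have hcoeff : ∀ τ, coeff τ (bracket (genMat K m n) d) = ∑ π : Equiv.Perm (Fin m),
      (Equiv.Perm.sign π) • (if (∑ i, Finsupp.single (π i, d i) 1) = τ then (1 : K) else 0) := by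
    intro τ
    rw [hdet, coeff_sum]
    refine Finset.sum_congr rfl fun π _ => ?_
    rw [Units.smul_def, Units.smul_def, coeff_smul, coeff_monomial]
  constructor
  · rw [hcoeff, Finset.sum_eq_single 1]
    · simp [rowExp]
    · intro π _ hπ
      rw [if_neg (fun h => by have := hwt π hπ; rw [h] at this; exact lt_irrefl _ this), smul_zero]
    · simp
  · intro τ hne hle
    rw [hcoeff]
    refine Finset.sum_eq_zero fun π _ => ?_
    rw [if_neg, smul_zero]
    rintro rfl
    by_cases hπ : π = 1
    · exact hne (by simp [hπ, rowExp])
    · exact absurd (hwt π hπ) (not_lt.2 hle)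

end Cells

section Exchange

open MvPolynomial

lemma sum_neg_one_pow_mul_bracket {S : Type*} [CommRing S] {m n : ℕ}
    (X : Matrix (Fin m) (Fin n) S) (i : Fin m) (s : Fin (m + 1) → Fin n) :
    ∑ t : Fin (m + 1), (-1) ^ t.val * X i (s t) * bracket X (s ∘ t.succAbove) = 0 := by
  let M : Matrix (Fin (m + 1)) (Fin (m + 1)) S :=
    Matrix.of (Fin.cons (fun j => X i (s j)) (fun r j => X r (s j)))
  have h0 : M.det = 0 := by
    refine Matrix.det_zero_of_row_eq (i := 0) (j := i.succ) (Fin.succ_ne_zero i).symm ?_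
    funext j
    simp [M]
  rw [← h0, Matrix.det_succ_row_zero]
  rfl

variable {m n k : ℕ}

/-- The weight of the `t`-th term of the linear relation between maximal minors. -/
def relWt (i : Fin m) (s : Fin (m + 1) → Fin n) (t : Fin (m + 1)) : ℤ :=
  i.val * (s t).val + ∑ r : Fin m, (r.val : ℤ) * (s (t.succAbove r)).val

lemma relWt_castSucc_sub_succ (i : Fin m) (s : Fin (m + 1) → Fin n) (t : Fin m) :
    relWt i s t.castSucc - relWt i s t.succ =
      ((t.val : ℤ) - i.val) * ((s t.succ).val - (s t.castSucc).val) := by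
  have h1 : ∑ r : Fin m, (r.val : ℤ) * (s (t.castSucc.succAbove r)).val -
      ∑ r : Fin m, (r.val : ℤ) * (s (t.succ.succAbove r)).val =
      t.val * ((s t.succ).val - (s t.castSucc).val) := by
    rw [← Finset.sum_sub_distrib, Finset.sum_eq_single t]
    · rw [Fin.succAbove_castSucc_self, Fin.succAbove_succ_self]; ring
    · intro r _ hr
      rcases lt_or_gt_of_ne hr with h | h
      · rw [Fin.succAbove_castSucc_of_lt _ _ h, Fin.succAbove_succ_of_le _ _ h.le, sub_self]
      · rw [Fin.succAbove_castSucc_of_le _ _ h.le, Fin.succAbove_succ_of_lt _ _ h, sub_self]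
    · simp
  rw [relWt, relWt]
  linear_combination h1

lemma relWt_castSucc_eq_succ (i : Fin m) (s : Fin (m + 1) → Fin n) :
    relWt i s i.castSucc = relWt i s i.succ := by
  rw [← sub_eq_zero, relWt_castSucc_sub_succ, sub_self, zero_mul]

lemma relWt_lt (i : Fin m) {s : Fin (m + 1) → Fin n} (hs : StrictMono s) (t : Fin (m + 1))
    (h0 : t ≠ i.castSucc) (h1 : t ≠ i.succ) : relWt i s t < relWt i s i.castSucc := by
  have hpos : ∀ r : Fin m, (0 : ℤ) < (s r.succ).val - (s r.castSucc).val := fun r => by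
    have : (s r.castSucc).val < (s r.succ).val := hs (Fin.castSucc_lt_succ)
    omega
  have hdown : ∀ (c : ℕ) (t : Fin (m + 1)), t.val + c + 1 = i.val →
      relWt i s t < relWt i s i.castSucc := by
    intro c
    induction c with
    | zero =>
      intro t ht
      obtain ⟨t, rfl⟩ : ∃ t' : Fin m, t = t'.castSucc := ⟨⟨t.val, by omega⟩, rfl⟩
      have heq : t.succ = i.castSucc := Fin.ext (by simpa using ht)
      rw [← heq, ← sub_neg, relWt_castSucc_sub_succ]
      refine mul_neg_of_neg_of_pos ?_ (hpos t)
      rw [Fin.val_castSucc] at ht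
      omega
    | succ c ih =>
      intro t ht
      obtain ⟨t, rfl⟩ : ∃ t' : Fin m, t = t'.castSucc := ⟨⟨t.val, by omega⟩, rfl⟩
      rw [Fin.val_castSucc] at ht
      refine lt_trans ?_ (ih t.succ (by rw [Fin.val_succ]; omega))
      rw [← sub_neg, relWt_castSucc_sub_succ]
      exact mul_neg_of_neg_of_pos (by omega) (hpos t)
  have hup : ∀ (c : ℕ) (t : Fin (m + 1)), t.val = i.val + 2 + c →
      relWt i s t < relWt i s i.castSucc := by
    intro c
    induction c with
    | zero =>
      intro t ht
      obtain ⟨t, rfl⟩ : ∃ t' : Fin m, t = t'.succ :=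
        ⟨⟨t.val - 1, by omega⟩, Fin.ext (by simp; omega)⟩
      rw [Fin.val_succ] at ht
      have heq : i.succ = t.castSucc := Fin.ext (by simp; omega)
      rw [relWt_castSucc_eq_succ, heq, ← sub_pos, relWt_castSucc_sub_succ]
      exact mul_pos (by omega) (hpos t)
    | succ c ih =>
      intro t ht
      obtain ⟨t, rfl⟩ : ∃ t' : Fin m, t = t'.succ :=
        ⟨⟨t.val - 1, by omega⟩, Fin.ext (by simp; omega)⟩
      rw [Fin.val_succ] at ht
      refine lt_trans ?_ (ih t.castSucc (by rw [Fin.val_castSucc]; omega))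
      rw [← sub_pos, relWt_castSucc_sub_succ]
      exact mul_pos (by omega) (hpos t)
  have h0' : t.val ≠ i.val := fun h => h0 (Fin.ext (by simpa using h))
  have h1' : t.val ≠ i.val + 1 := fun h => h1 (Fin.ext (by simpa using h))
  rcases lt_or_ge t.val i.val with h | h
  · exact hdown (i.val - t.val - 1) t (by omega)
  · exact hup (t.val - i.val - 2) t (by omega)

lemma cellWt_single_add_rowExp (i : Fin m) (s : Fin (m + 1) → Fin n) (t : Fin (m + 1)) :
    (cellWt m n (Finsupp.single (i, s t) 1 + rowExp (s ∘ t.succAbove)) : ℤ) = relWt i s t := by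
  rw [map_add, rowExp, cellWt_sum_single (fun i => i), relWt, cellWt, Finsupp.weight_single]
  simp

lemma X_mul_bracket_sub_mem (K : Type*) [CommRing K] {δ : Fin m → Fin n} (hδ : StrictMono δ)
    {i : Fin m} {v : Fin n} (hv : v < δ i) (hv' : ∀ j < i, δ j < v) :
    X (i, v) * bracket (genMat K m n) δ -
        X (i, δ i) * bracket (genMat K m n) (Function.update δ i v) ∈
      Submodule.span K {z | ∃ (w : Fin n) (d : Fin m → Fin n), StrictMono d ∧
        z = X (i, w) * bracket (genMat K m n) d ∧
        cellWt m n (Finsupp.single (i, w) 1 + rowExp d) <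
          cellWt m n (Finsupp.single (i, v) 1 + rowExp δ)} := by
  let s : Fin (m + 1) → Fin n := Fin.insertNth (α := fun _ => Fin n) i.castSucc v δ
  have hs0 : s i.castSucc = v := by simp [s]
  have hs1 : s i.succ = δ i := by
    have : s (i.castSucc.succAbove i) = δ i :=
      Fin.insertNth_apply_succAbove (α := fun _ => Fin n) i.castSucc v δ i
    rwa [Fin.succAbove_castSucc_self] at this
  have hc0 : s ∘ i.castSucc.succAbove = δ := by funext r; simp [s]
  have hc1 : s ∘ i.succ.succAbove = Function.update δ i v := by
    funext r
    by_cases hr : r = i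
    · subst hr
      simp [Fin.succAbove_succ_self, hs0]
    · rw [Function.update_of_ne hr, ← congrFun hc0 r]
      simp only [Function.comp]
      rcases lt_or_gt_of_ne hr with h | h
      · rw [Fin.succAbove_castSucc_of_lt _ _ h, Fin.succAbove_succ_of_le _ _ h.le]
      · rw [Fin.succAbove_castSucc_of_le _ _ h.le, Fin.succAbove_succ_of_lt _ _ h]
  have hs : StrictMono s := by
    refine (Fin.strictMono_insertNth_iff _ _ _).2 ⟨hδ, fun j hj => ?_, fun j hj => ?_⟩
    · exact hv' j (Fin.castSucc_lt_castSucc_iff.1 hj)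
    · exact lt_of_lt_of_le hv (hδ.monotone (Fin.castSucc_le_castSucc_iff.1 hj))
  have hrel := sum_neg_one_pow_mul_bracket (genMat K m n) i s
  have hne : i.castSucc ≠ i.succ := (Fin.castSucc_lt_succ).ne
  rw [← Finset.add_sum_erase _ _ (Finset.mem_univ i.castSucc),
    ← Finset.add_sum_erase _ _ (Finset.mem_erase.2 ⟨hne.symm, Finset.mem_univ i.succ⟩),
    hc0, hc1, hs0, hs1, Fin.val_castSucc, Fin.val_succ] at hrel
  have hX : ∀ w, genMat K m n i w = X (i, w) := fun w => rfl
  simp only [hX] at hrel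
  have hsub : X (i, v) * bracket (genMat K m n) δ -
        X (i, δ i) * bracket (genMat K m n) (Function.update δ i v) =
      ∑ t ∈ (Finset.univ.erase i.castSucc).erase i.succ, ((-1) ^ (i.val + 1 + t.val) : K) •
        (X (i, s t) * bracket (genMat K m n) (s ∘ t.succAbove)) := by
    have h2 : ((-1) ^ i.val * (-1) ^ i.val : MvPolynomial (Fin m × Fin n) K) = 1 := by
      rw [← mul_pow]; simp
    have h3 : ∀ t : Fin (m + 1), ((-1) ^ (i.val + 1 + t.val) : K) •
        (X (i, s t) * bracket (genMat K m n) (s ∘ t.succAbove)) = - ((-1) ^ i.val *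
        ((-1) ^ t.val * X (i, s t) * bracket (genMat K m n) (s ∘ t.succAbove))) := by
      intro t
      have hC : (C ((-1) ^ (i.val + 1 + t.val)) : MvPolynomial (Fin m × Fin n) K) =
          (-1) ^ (i.val + 1 + t.val) := by simp
      rw [smul_eq_C_mul, hC, pow_add, pow_add, pow_one]
      ring
    simp only [h3]
    rw [Finset.sum_neg_distrib, ← Finset.mul_sum]
    linear_combination (-1 : MvPolynomial (Fin m × Fin n) K) ^ i.val * hrel - (X (i, v) * bracket (genMat K m n) δ -
        X (i, δ i) * bracket (genMat K m n) (Function.update δ i v)) * h2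
  rw [hsub]
  refine Submodule.sum_mem _ fun t ht => Submodule.smul_mem _ _ (Submodule.subset_span
    ⟨s t, s ∘ t.succAbove, hs.comp (Fin.strictMono_succAbove t), rfl, ?_⟩)
  simp only [Finset.mem_erase] at ht
  have hlt := relWt_lt i hs t ht.2.1 ht.1
  rw [← cellWt_single_add_rowExp, ← cellWt_single_add_rowExp, hc0, hs0] at hlt
  exact_mod_cast hlt

end Exchange

section NormalForm

open MvPolynomial

variable {m n k : ℕ}

lemma val_add_le_of_strictMono {d : Fin m → Fin n} (hd : StrictMono d) (c : ℕ) :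
    ∀ i j : Fin m, i.val + c = j.val → (d i).val + c ≤ (d j).val := by
  induction c with
  | zero => intro i j h; rw [Fin.ext (a := i) (b := j) (by omega)]; omega
  | succ c ih =>
    intro i j h
    have h1 := ih i ⟨i.val + c, by omega⟩ rfl
    have h2 : d ⟨i.val + c, by omega⟩ < d j := hd (by rw [Fin.lt_def]; simp; omega)
    rw [Fin.lt_def] at h2
    omega

lemma le_val_of_strictMono {d : Fin m → Fin n} (hd : StrictMono d) (i : Fin m) :
    i.val ≤ (d i).val := by
  have := val_add_le_of_strictMono hd i.val ⟨0, i.pos⟩ i (by simp)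
  omega

lemma val_add_le_add_of_strictMono {d : Fin m → Fin n} (hd : StrictMono d) (i : Fin m) :
    (d i).val + m ≤ i.val + n := by
  have := val_add_le_of_strictMono hd (m - 1 - i.val) i ⟨m - 1, by have := i.pos; omega⟩
    (by simp; omega)
  have := (d ⟨m - 1, by have := i.pos; omega⟩).2
  omega

lemma rowExp_apply (d : Fin m → Fin n) (i : Fin m) (v : Fin n) :
    rowExp d (i, v) = if d i = v then 1 else 0 := by
  classical
  rw [rowExp, Finsupp.finsetSum_apply, Finset.sum_eq_single i]
  · simp [Finsupp.single_apply]
  · intro j _ hj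
    simp [hj]
  · simp

lemma tabExp_apply (D : Fin k → Fin m → Fin n) (i : Fin m) (v : Fin n) :
    tabExp D (i, v) = (Finset.univ.filter fun t => D t i = v).card := by
  rw [tabExp, Finsupp.finsetSum_apply, Finset.card_filter]
  exact Finset.sum_congr rfl fun t _ => rowExp_apply _ _ _

/-- No variable of the monomial of exponent `ν` can be exchanged with a larger entry of `C` in the
same position. -/
def NoMove (C : Fin k → Fin m → Fin n) (ν : Fin m × Fin n →₀ ℕ) : Prop :=
  ∀ t i v, v < C t i → (∀ j < i, C t j < v) → ν (i, v) = 0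

/-- The positions at which variables can be exchanged. -/
def bandCells (m n : ℕ) : Set (Fin m × Fin n) :=
  {p | p.1.val ≤ p.2.val ∧ p.2.val + m < p.1.val + n}

lemma mem_bandCells_of_move {d : Fin m → Fin n} (hd : StrictMono d) {i : Fin m} {v : Fin n}
    (hv : v < d i) (hv' : ∀ j < i, d j < v) : (i, v) ∈ bandCells m n := by
  constructor
  · rcases Nat.eq_zero_or_pos i.val with h | h
    · simp [h]
    · have h1 := hv' ⟨i.val - 1, by omega⟩ (by rw [Fin.lt_def]; simp; omega)
      have h2 := le_val_of_strictMono hd ⟨i.val - 1, by omega⟩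
      rw [Fin.lt_def] at h1
      simp only at h2 ⊢
      omega
  · have h1 := val_add_le_add_of_strictMono hd i
    rw [Fin.lt_def] at hv
    simp only
    omega

lemma NoMove.not_entry_lt {C C' : Fin k → Fin m → Fin n} (hC : IsStandard C) (hC' : IsStandard C')
    {ν ν' : Fin m × Fin n →₀ ℕ} (hν : NoMove C ν)
    (h : ∀ p ∈ bandCells m n, (ν + tabExp C) p = (ν' + tabExp C') p) {i : Fin m} {t : Fin k}
    (hi : ∀ j < i, ∀ t, C t j = C' t j) (ht : ∀ t' < t, C t' i = C' t' i) :
    ¬ C' t i < C t i := by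
  intro hlt
  have hprev : ∀ j < i, C t j < C' t i := fun j hj => by rw [hi j hj]; exact hC'.1 t hj
  have h1 := h (i, C' t i) (mem_bandCells_of_move (hC.1 t) hlt hprev)
  rw [Finsupp.add_apply, Finsupp.add_apply, hν t i _ hlt hprev, zero_add, tabExp_apply,
    tabExp_apply] at h1
  have h2 : (Finset.univ.filter fun t' => C t' i = C' t i) ⊂
      (Finset.univ.filter fun t' => C' t' i = C' t i) := by
    rw [Finset.ssubset_iff_of_subset]
    · refine ⟨t, by simp, ?_⟩
      simp [hlt.ne']
    · intro t' ht'
      simp only [Finset.mem_filter, Finset.mem_univ, true_and] at ht' ⊢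
      rcases lt_or_ge t' t with h3 | h3
      · rw [← ht t' h3, ht']
      · exact absurd (ht' ▸ hC.2 h3 i) (not_le.2 hlt)
  have h3 := Finset.card_lt_card h2
  omega

lemma NoMove.unique {C C' : Fin k → Fin m → Fin n} (hC : IsStandard C) (hC' : IsStandard C')
    {ν ν' : Fin m × Fin n →₀ ℕ} (hν : NoMove C ν) (hν' : NoMove C' ν')
    (h : ∀ p ∈ bandCells m n, (ν + tabExp C) p = (ν' + tabExp C') p) : C = C' := by
  suffices H : ∀ i : Fin m, ∀ t, C t i = C' t i from funext fun t => funext fun i => H i t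
  intro i
  induction i using WellFoundedLT.induction with | _ i hi
  intro t
  induction t using WellFoundedLT.induction with | _ t ht
  exact le_antisymm (not_lt.1 (hν.not_entry_lt hC hC' h hi ht))
    (not_lt.1 (hν'.not_entry_lt hC' hC (fun p hp => (h p hp).symm) (fun j hj t => (hi j hj t).symm)
      (fun t' h' => (ht t' h').symm)))

lemma tabExp_injOn : Set.InjOn (tabExp (m := m) (n := n) (k := k)) {C | IsStandard C} := by
  intro C hC C' hC' h
  exact NoMove.unique (ν := 0) (ν' := 0) hC hC' (fun _ _ _ _ _ => rfl) (fun _ _ _ _ _ => rfl)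
    (fun p _ => by rw [h])

variable (K : Type*) [CommRing K]

/-- A monomial times a product of maximal minors of the generic matrix. -/
noncomputable def tabPoly (D : Fin k → Fin m → Fin n) (ν : Fin m × Fin n →₀ ℕ) :
    MvPolynomial (Fin m × Fin n) K :=
  monomial ν 1 * bracketProd (genMat K m n) D

lemma isLead_bracketProd {D : Fin k → Fin m → Fin n} (hD : ∀ t, StrictMono (D t)) :
    IsLead (cellWt m n) (bracketProd (genMat K m n) D) (tabExp D) :=
  isLead_prod _ fun t _ => isLead_bracket K (hD t)

lemma isLead_tabPoly {D : Fin k → Fin m → Fin n} (hD : ∀ t, StrictMono (D t))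
    (ν : Fin m × Fin n →₀ ℕ) : IsLead (cellWt m n) (tabPoly K D ν) (ν + tabExp D) :=
  (isLead_monomial _ ν).mul (isLead_bracketProd K hD)

/-- The span of the products of monomials and maximal minors of weight less than `w`. -/
noncomputable def lowerSpan (m n k w : ℕ) : Submodule K (MvPolynomial (Fin m × Fin n) K) :=
  Submodule.span K {z | ∃ (D : Fin k → Fin m → Fin n) (ν : Fin m × Fin n →₀ ℕ),
    (∀ t, StrictMono (D t)) ∧ z = tabPoly K D ν ∧ cellWt m n (ν + tabExp D) < w}

lemma exists_isStandard_sub_mem [Nontrivial K] {D : Fin k → Fin m → Fin n}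
    (hD : ∀ t, StrictMono (D t)) (ν : Fin m × Fin n →₀ ℕ) :
    ∃ C : Fin k → Fin m → Fin n, IsStandard C ∧ tabExp C = tabExp D ∧
      tabPoly K D ν - tabPoly K C ν ∈ lowerSpan K m n k (cellWt m n (ν + tabExp D)) := by
  have hmem : bracketProd (genMat K m n) D ∈ Submodule.span K
      (bracketProd (genMat K m n) '' {C : Fin k → Fin m → Fin n | IsStandard C}) := by
    have h1 := bracketProd_mem_closure_isStandard (genMat K m n) D
    have h2 : AddSubgroup.closure {z | ∃ C : Fin k → Fin m → Fin n,
        IsStandard C ∧ z = bracketProd (genMat K m n) C} ≤ (Submodule.span K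
      (bracketProd (genMat K m n) '' {C : Fin k → Fin m → Fin n | IsStandard C})).toAddSubgroup := by
      rw [AddSubgroup.closure_le]
      rintro _ ⟨C, hC, rfl⟩
      exact Submodule.subset_span ⟨C, hC, rfl⟩
    exact h2 h1
  obtain ⟨C, hC, hexp, hsub⟩ := exists_isLead_sub_mem_span (lead := tabExp) _
    (fun C hC => isLead_bracketProd K hC.1) tabExp_injOn (isLead_bracketProd K hD) hmem
  refine ⟨C, hC, hexp, ?_⟩
  rw [tabPoly, tabPoly, ← mul_sub]
  refine Submodule.span_induction ?_ ?_ ?_ ?_ hsub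
  · rintro _ ⟨C', hC', rfl⟩
    refine Submodule.subset_span ⟨C', ν, hC'.1.1, rfl, ?_⟩
    rw [map_add, map_add]
    exact Nat.add_lt_add_left hC'.2 _
  · rw [mul_zero]; exact zero_mem _
  · intro x y _ _ hx hy
    rw [mul_add]; exact add_mem hx hy
  · intro a x _ hx
    rw [mul_smul_comm]; exact Submodule.smul_mem _ _ hx

end NormalForm

section Spanning

open MvPolynomial

variable {m n k : ℕ}

lemma rowExp_update_add (d : Fin m → Fin n) (i : Fin m) (v : Fin n) :
    Finsupp.single (i, d i) 1 + rowExp (Function.update d i v) =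
      Finsupp.single (i, v) 1 + rowExp d := by
  classical
  rw [rowExp, rowExp, ← Finset.add_sum_erase _ _ (Finset.mem_univ i),
    ← Finset.add_sum_erase Finset.univ (fun j => Finsupp.single (j, d j) 1) (Finset.mem_univ i),
    Function.update_self, add_left_comm]
  congr 2
  refine Finset.sum_congr rfl fun j hj => ?_
  rw [Function.update_of_ne (Finset.ne_of_mem_erase hj)]

lemma tabExp_update (D : Fin k → Fin m → Fin n) (t : Fin k) (d : Fin m → Fin n) :
    tabExp (Function.update D t d) = rowExp d + ∑ s ∈ Finset.univ.erase t, rowExp (D s) := by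
  rw [tabExp, ← Finset.add_sum_erase _ _ (Finset.mem_univ t), Function.update_self]
  congr 1
  refine Finset.sum_congr rfl fun j hj => ?_
  rw [Function.update_of_ne (Finset.ne_of_mem_erase hj)]

variable (K : Type*) [CommRing K]

lemma tabPoly_update (D : Fin k → Fin m → Fin n) (t : Fin k) (d : Fin m → Fin n)
    (p : Fin m × Fin n) (ν : Fin m × Fin n →₀ ℕ) :
    tabPoly K (Function.update D t d) (ν + Finsupp.single p 1) =
      (monomial ν 1 * ∏ s ∈ Finset.univ.erase t, bracket (genMat K m n) (D s)) *
        (X p * bracket (genMat K m n) d) := by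
  rw [tabPoly, bracketProd, ← Finset.mul_prod_erase _ _ (Finset.mem_univ t),
    Function.update_self, monomial_add_single, pow_one, Finset.prod_congr rfl
      (g := fun s => bracket (genMat K m n) (D s))]
  · ring
  · intro j hj
    rw [Function.update_of_ne (Finset.ne_of_mem_erase hj)]

lemma tabPoly_sub_tabPoly_update_mem {D : Fin k → Fin m → Fin n} (hD : ∀ t, StrictMono (D t))
    (ν : Fin m × Fin n →₀ ℕ) {t : Fin k} {i : Fin m} {v : Fin n} (hv : v < D t i)
    (hv' : ∀ j < i, D t j < v) :
    tabPoly K D (ν + Finsupp.single (i, v) 1) -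
        tabPoly K (Function.update D t (Function.update (D t) i v))
          (ν + Finsupp.single (i, D t i) 1) ∈
      lowerSpan K m n k (cellWt m n (ν + Finsupp.single (i, v) 1 + tabExp D)) := by
  have h1 := tabPoly_update K D t (D t) (i, v) ν
  have hE := tabExp_update D t (D t)
  rw [Function.update_eq_self] at h1 hE
  rw [h1, tabPoly_update, ← mul_sub]
  refine Submodule.span_induction ?_ ?_ ?_ ?_ (X_mul_bracket_sub_mem K (hD t) hv hv')
  · rintro _ ⟨w, d, hd, rfl, hlt⟩
    refine Submodule.subset_span ⟨Function.update D t d, ν + Finsupp.single (i, w) 1, ?_,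
      (tabPoly_update K D t d (i, w) ν).symm, ?_⟩
    · intro s
      rcases eq_or_ne s t with rfl | hs
      · rwa [Function.update_self]
      · rw [Function.update_of_ne hs]; exact hD s
    · rw [tabExp_update, hE]
      simp only [map_add] at hlt ⊢
      omega
  · rw [mul_zero]; exact zero_mem _
  · intro x y _ _ hx hy
    rw [mul_add]; exact add_mem hx hy
  · intro a x _ hx
    rw [mul_smul_comm]; exact Submodule.smul_mem _ _ hx

/-- The total column index of an exponent. -/
noncomputable def columnWt (m n : ℕ) : (Fin m × Fin n →₀ ℕ) →+ ℕ :=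
  (Finsupp.weight fun p : Fin m × Fin n => p.2.val)

lemma strictMono_update {d : Fin m → Fin n} (hd : StrictMono d) {i : Fin m} {v : Fin n}
    (hv : v < d i) (hv' : ∀ j < i, d j < v) : StrictMono (Function.update d i v) := by
  intro a b hab
  rcases eq_or_ne a i with rfl | ha
  · rw [Function.update_self, Function.update_of_ne hab.ne']
    exact hv.trans (hd hab)
  · rw [Function.update_of_ne ha]
    rcases eq_or_ne b i with rfl | hb
    · rw [Function.update_self]; exact hv' a hab
    · rw [Function.update_of_ne hb]; exact hd hab

/-- The span of the products of monomials and standard products of maximal minors in which no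
exchange is possible. -/
noncomputable def normalSpan (m n k : ℕ) : Submodule K (MvPolynomial (Fin m × Fin n) K) :=
  Submodule.span K {z | ∃ (C : Fin k → Fin m → Fin n) (ν : Fin m × Fin n →₀ ℕ),
    IsStandard C ∧ NoMove C ν ∧ z = tabPoly K C ν}

lemma tabPoly_mem_normalSpan [Nontrivial K] (w : ℕ) : ∀ (c : ℕ) (D : Fin k → Fin m → Fin n)
    (ν : Fin m × Fin n →₀ ℕ), (∀ t, StrictMono (D t)) → cellWt m n (ν + tabExp D) = w →
    columnWt m n (tabExp D) = c → tabPoly K D ν ∈ normalSpan K m n k := by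
  induction w using Nat.strong_induction_on with | _ w ihw
  intro c
  induction c using Nat.strong_induction_on with | _ c ihc
  intro D ν hD hw hc
  have hlow : lowerSpan K m n k w ≤ normalSpan K m n k := by
    refine Submodule.span_le.2 ?_
    rintro _ ⟨D', ν', hD', rfl, hlt⟩
    exact ihw _ hlt _ D' ν' hD' rfl rfl
  obtain ⟨C, hC, hexp, hsub⟩ := exists_isStandard_sub_mem K hD ν
  rw [hw] at hsub
  rw [← sub_add_cancel (tabPoly K D ν) (tabPoly K C ν)]
  refine add_mem (hlow hsub) ?_
  by_cases hmove : NoMove C ν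
  · exact Submodule.subset_span ⟨C, ν, hC, hmove, rfl⟩
  · simp only [NoMove, not_forall] at hmove
    obtain ⟨t, i, v, hv, hv', hν⟩ := hmove
    obtain ⟨ν, rfl⟩ : ∃ ν₀, ν = ν₀ + Finsupp.single (i, v) 1 :=
      ⟨ν - Finsupp.single (i, v) 1, (tsub_add_cancel_of_le (by
        rw [Finsupp.single_le_iff]; omega)).symm⟩
    have h2 := tabPoly_sub_tabPoly_update_mem K hC.1 ν hv hv'
    rw [hexp, hw] at h2
    rw [← sub_add_cancel (tabPoly K C (ν + Finsupp.single (i, v) 1))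
      (tabPoly K (Function.update C t (Function.update (C t) i v))
        (ν + Finsupp.single (i, C t i) 1))]
    refine add_mem (hlow h2) ?_
    have h3 := tabExp_update C t (C t)
    rw [Function.update_eq_self] at h3
    have h4 := tabExp_update C t (Function.update (C t) i v)
    have h5 := rowExp_update_add (C t) i v
    refine ihc _ ?_ _ _ ?_ ?_ rfl
    · have h6 := congrArg (columnWt m n) h5
      simp only [map_add, columnWt, Finsupp.weight_single, smul_eq_mul, one_mul] at h6
      rw [← hc, ← hexp, h4, h3, map_add, map_add]
      simp only [columnWt]
      rw [Fin.lt_def] at hv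
      omega
    · intro s
      rcases eq_or_ne s t with rfl | hs
      · rw [Function.update_self]; exact strictMono_update (hC.1 s) hv hv'
      · rw [Function.update_of_ne hs]; exact hC.1 s
    · have h6 := congrArg (cellWt m n) h5
      rw [← hw, ← hexp, h4, h3]
      simp only [map_add] at h6 ⊢
      omega

end Spanning

section Freeness

open MvPolynomial

variable {m n k : ℕ}

lemma minorsIdeal_eq_span_bracket {R : Type*} [CommRing R] (A : Matrix (Fin m) (Fin n) R) :
    minorsIdeal m A = Ideal.span {z | ∃ d : Fin m → Fin n, StrictMono d ∧ z = bracket A d} := by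
  refine le_antisymm (Ideal.span_le.2 ?_) (Ideal.span_le.2 ?_)
  · rintro _ ⟨f, g, hf, hg, rfl⟩
    obtain ⟨d, hd, -, h⟩ := exists_strictMono_bracket A hg
    have hmem : bracket A d ∈ Ideal.span
        {z | ∃ d : Fin m → Fin n, StrictMono d ∧ z = bracket A d} :=
      Ideal.subset_span ⟨d, hd, rfl⟩
    have h1 : (A.submatrix f g).det =
        Equiv.Perm.sign (Equiv.ofBijective f (Finite.injective_iff_bijective.1 hf)) *
          bracket A g := by
      rw [bracket, ← Matrix.det_permute]
      rfl
    rw [h1, SetLike.mem_coe]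
    refine Ideal.mul_mem_left _ _ ?_
    rcases h with h | h <;> rw [h]
    · exact hmem
    · exact neg_mem hmem
  · rintro _ ⟨d, hd, rfl⟩
    exact Ideal.subset_span ⟨id, d, Function.injective_id, hd.injective, rfl⟩

lemma minorsIdeal_pow_eq_span {R : Type*} [CommRing R] (A : Matrix (Fin m) (Fin n) R) :
    minorsIdeal m A ^ k = Ideal.span {z | ∃ D : Fin k → Fin m → Fin n,
      (∀ t, StrictMono (D t)) ∧ z = bracketProd A D} := by
  rw [minorsIdeal_eq_span_bracket, Ideal.span, Submodule.span_pow]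
  congr 1
  ext z
  rw [Set.mem_pow]
  constructor
  · rintro ⟨f, rfl⟩
    choose D hD hDf using fun t => (f t).2
    refine ⟨D, hD, ?_⟩
    rw [List.prod_ofFn]
    exact Finset.prod_congr rfl fun t _ => hDf t
  · rintro ⟨D, hD, rfl⟩
    refine ⟨fun t => ⟨bracket A (D t), D t, hD t, rfl⟩, ?_⟩
    rw [List.prod_ofFn]
    rfl

variable (K : Type*) [CommRing K]

lemma tabPoly_mem_pow {D : Fin k → Fin m → Fin n} (hD : ∀ t, StrictMono (D t))
    (ν : Fin m × Fin n →₀ ℕ) : tabPoly K D ν ∈ minorsIdeal m (genMat K m n) ^ k := by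
  rw [minorsIdeal_pow_eq_span]
  exact Ideal.mul_mem_left _ _ (Ideal.subset_span ⟨D, hD, rfl⟩)

lemma mem_normalSpan_of_mem_pow [Nontrivial K] {z : MvPolynomial (Fin m × Fin n) K}
    (hz : z ∈ minorsIdeal m (genMat K m n) ^ k) : z ∈ normalSpan K m n k := by
  rw [minorsIdeal_pow_eq_span] at hz
  refine Submodule.closure_induction (zero_mem _) (fun _ _ _ _ => add_mem) ?_ hz
  rintro f _ ⟨D, hD, rfl⟩
  rw [smul_eq_mul, f.as_sum, Finset.sum_mul]
  refine Submodule.sum_mem _ fun ν _ => ?_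
  rw [← mul_one (coeff ν f), ← smul_eq_mul (coeff ν f), ← smul_monomial, smul_mul_assoc]
  exact Submodule.smul_mem _ _ (tabPoly_mem_normalSpan K _ _ D ν hD rfl rfl)

/-- The variables outside the band. -/
abbrev OffBand (m n : ℕ) : Type := {p : Fin m × Fin n // p ∉ bandCells m n}

/-- The index set of a basis of the `k`-th power of the ideal of maximal minors over the polynomial
ring in the variables outside the band. -/
def NormalIndex (m n k : ℕ) : Type :=
  {c : (Fin k → Fin m → Fin n) × (Fin m × Fin n →₀ ℕ) //
    IsStandard c.1 ∧ NoMove c.1 c.2 ∧ ∀ p ∉ bandCells m n, c.2 p = 0}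

/-- The basis elements. -/
noncomputable def normalPoly (c : NormalIndex m n k) : MvPolynomial (Fin m × Fin n) K :=
  tabPoly K c.1.1 c.1.2

/-- Extension of exponents by zero. -/
noncomputable def extExp (α : OffBand m n →₀ ℕ) : Fin m × Fin n →₀ ℕ := α.mapDomain Subtype.val

lemma extExp_apply (α : OffBand m n →₀ ℕ) (p : OffBand m n) : extExp α p.1 = α p :=
  Finsupp.mapDomain_apply Subtype.val_injective _ _

lemma extExp_apply_of_mem (α : OffBand m n →₀ ℕ) {p : Fin m × Fin n} (hp : p ∈ bandCells m n) :
    extExp α p = 0 := by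
  refine Finsupp.mapDomain_of_notMem_range _ _ ?_
  rintro ⟨q, rfl⟩
  exact q.2 hp

lemma NoMove.add_extExp {C : Fin k → Fin m → Fin n} (hC : IsStandard C)
    {ν : Fin m × Fin n →₀ ℕ} (h : NoMove C ν) (α : OffBand m n →₀ ℕ) :
    NoMove C (ν + extExp α) := by
  intro t i v hv hw
  rw [Finsupp.add_apply, h t i v hv hw,
    extExp_apply_of_mem α (mem_bandCells_of_move (hC.1 t) hv hw)]

/-- The exponent of the leading monomial of a basis element times a monomial. -/
noncomputable def leadExp (x : (_ : NormalIndex m n k) × (OffBand m n →₀ ℕ)) :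
    Fin m × Fin n →₀ ℕ := x.1.1.2 + extExp x.2 + tabExp x.1.1.1

lemma leadExp_injective :
    Function.Injective (leadExp : (_ : NormalIndex m n k) × (OffBand m n →₀ ℕ) → _) := by
  rintro ⟨⟨⟨C, ν⟩, hC, hν, hν0⟩, α⟩ ⟨⟨⟨C', ν'⟩, hC', hν', hν0'⟩, α'⟩ h
  simp only [leadExp] at h hC hν hν0 hC' hν' hν0'
  obtain rfl : C = C' := NoMove.unique hC hC' (hν.add_extExp hC α) (hν'.add_extExp hC' α')
    fun p _ => by rw [h]
  have h1 := add_right_cancel h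
  obtain rfl : α = α' := by
    ext p
    have h2 := DFunLike.congr_fun h1 p.1
    simpa [hν0 p.1 p.2, hν0' p.1 p.2, extExp_apply] using h2
  obtain rfl := add_right_cancel h1
  rfl

lemma tabPoly_add (C : Fin k → Fin m → Fin n) (ν α : Fin m × Fin n →₀ ℕ) :
    tabPoly K C (ν + α) = monomial α 1 * tabPoly K C ν := by
  rw [tabPoly, tabPoly, ← mul_assoc, monomial_mul, one_mul, add_comm]

lemma rename_mul_tabPoly (f : MvPolynomial (OffBand m n) K) (C : Fin k → Fin m → Fin n)
    (ν : Fin m × Fin n →₀ ℕ) : rename Subtype.val f * tabPoly K C ν =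
      ∑ α ∈ f.support, coeff α f • tabPoly K C (ν + extExp α) := by
  conv_lhs => rw [f.as_sum]
  rw [map_sum, Finset.sum_mul]
  refine Finset.sum_congr rfl fun α _ => ?_
  rw [rename_monomial, tabPoly_add, ← smul_mul_assoc, smul_monomial, smul_eq_mul, mul_one, extExp]

variable [Algebra (MvPolynomial (OffBand m n) K) (MvPolynomial (Fin m × Fin n) K)]

lemma linearIndependent_normalPoly
    (h : ∀ f, algebraMap (MvPolynomial (OffBand m n) K) (MvPolynomial (Fin m × Fin n) K) f =
      rename Subtype.val f) :
    LinearIndependent (MvPolynomial (OffBand m n) K)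
      (normalPoly K : NormalIndex m n k → MvPolynomial (Fin m × Fin n) K) := by
  classical
  rw [linearIndependent_iff]
  intro l hl
  by_contra hne
  have hsum : ∑ x ∈ l.support.sigma fun c => (l c).support,
      coeff x.2 (l x.1) • tabPoly K x.1.1.1 (x.1.1.2 + extExp x.2) = 0 := by
    rw [Finset.sum_sigma, ← hl, Finsupp.linearCombination_apply, Finsupp.sum]
    refine Finset.sum_congr rfl fun c _ => ?_
    rw [Algebra.smul_def, h, normalPoly, rename_mul_tabPoly]
  have hnon : (l.support.sigma fun c => (l c).support).Nonempty := by
    obtain ⟨c, hc⟩ := Finsupp.support_nonempty_iff.2 hne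
    obtain ⟨α, hα⟩ := MvPolynomial.support_nonempty.2 (Finsupp.mem_support_iff.1 hc)
    exact ⟨⟨c, α⟩, Finset.mem_sigma.2 ⟨hc, hα⟩⟩
  obtain ⟨x, hx, hmax⟩ := Finset.exists_max_image _ (fun x => cellWt m n (leadExp x)) hnon
  have hlead : ∀ y : (_ : NormalIndex m n k) × (OffBand m n →₀ ℕ),
      IsLead (cellWt m n) (tabPoly K y.1.1.1 (y.1.1.2 + extExp y.2)) (leadExp y) :=
    fun y => isLead_tabPoly K y.1.2.1.1 _
  have hcoeff := congrArg (coeff (leadExp x)) hsum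
  rw [coeff_sum, Finset.sum_eq_single x, coeff_smul, (hlead x).1, smul_eq_mul, mul_one,
    coeff_zero] at hcoeff
  · exact MvPolynomial.mem_support_iff.1 (Finset.mem_sigma.1 hx).2 hcoeff
  · intro y hy hyx
    rw [coeff_smul, (hlead y).2 _ (fun hxy => hyx (leadExp_injective hxy).symm) (hmax y hy),
      smul_zero]
  · exact fun hx' => absurd hx hx'

lemma span_normalPoly [Nontrivial K]
    (h : ∀ f, algebraMap (MvPolynomial (OffBand m n) K) (MvPolynomial (Fin m × Fin n) K) f =
      rename Subtype.val f) :
    Submodule.span (MvPolynomial (OffBand m n) K)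
      (Set.range (normalPoly K : NormalIndex m n k → MvPolynomial (Fin m × Fin n) K)) =
    (minorsIdeal m (genMat K m n) ^ k).restrictScalars (MvPolynomial (OffBand m n) K) := by
  classical
  refine le_antisymm (Submodule.span_le.2 ?_) ?_
  · rintro _ ⟨c, rfl⟩
    exact tabPoly_mem_pow K c.2.1.1 _
  · intro z hz
    have hz' := mem_normalSpan_of_mem_pow K hz
    refine Submodule.span_induction ?_ (zero_mem _) (fun _ _ _ _ => add_mem) ?_ hz'
    · rintro _ ⟨C, ν, hC, hν, rfl⟩
      obtain ⟨α, hα⟩ : ∃ α : OffBand m n →₀ ℕ, ∀ p, α p = ν p.1 :=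
        ⟨Finsupp.equivFunOnFinite.symm fun p => ν p.1, fun p => rfl⟩
      obtain ⟨ν', hν'⟩ : ∃ ν' : Fin m × Fin n →₀ ℕ,
          ∀ p, ν' p = if p ∈ bandCells m n then ν p else 0 :=
        ⟨Finsupp.equivFunOnFinite.symm fun p => if p ∈ bandCells m n then ν p else 0,
          fun p => rfl⟩
      have hsplit : ν = ν' + extExp α := by
        ext p
        rw [Finsupp.add_apply, hν']
        split_ifs with hp
        · rw [extExp_apply_of_mem α hp, add_zero]
        · rw [extExp_apply α ⟨p, hp⟩, hα, zero_add]
      rw [hsplit, tabPoly_add, show (monomial (extExp α) (1 : K)) =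
        algebraMap (MvPolynomial (OffBand m n) K) _ (monomial α 1) by
          rw [h, rename_monomial, extExp], ← Algebra.smul_def]
      refine Submodule.smul_mem _ _ (Submodule.subset_span ⟨⟨(C, ν'), hC, ?_, ?_⟩, rfl⟩)
      · intro t i v hv hv'
        simp only [hν']
        rw [hν t i v hv hv', ite_self]
      · intro p hp
        simp only [hν', if_neg hp]
    · intro a z _ hz
      rw [show a • z = (C a : MvPolynomial (OffBand m n) K) • z by
        rw [Algebra.smul_def (C a), h, rename_C, C_mul']]
      exact Submodule.smul_mem _ _ hz

lemma flat_minorsIdeal_pow [Nontrivial K]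
    (h : ∀ f, algebraMap (MvPolynomial (OffBand m n) K) (MvPolynomial (Fin m × Fin n) K) f =
      rename Subtype.val f) :
    Module.Flat (MvPolynomial (OffBand m n) K) ↥(minorsIdeal m (genMat K m n) ^ k) := by
  have h1 : Module.Free (MvPolynomial (OffBand m n) K) (Submodule.span
      (MvPolynomial (OffBand m n) K) (Set.range
        (normalPoly K : NormalIndex m n k → MvPolynomial (Fin m × Fin n) K))) :=
    Module.Free.of_basis (Module.Basis.span (linearIndependent_normalPoly K h))
  rw [span_normalPoly K h] at h1
  exact (inferInstance : Module.Flat (MvPolynomial (OffBand m n) K)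
    ↥((minorsIdeal m (genMat K m n) ^ k).restrictScalars (MvPolynomial (OffBand m n) K)))

end Freeness

section FlatDimension

open MvPolynomial

lemma bijective_aeval_of_equiv {K σ τ ω : Type*} [CommRing K] (e : τ ⊕ ω ≃ σ)
    [Algebra (MvPolynomial ω K) (MvPolynomial σ K)]
    (h : ∀ f, algebraMap (MvPolynomial ω K) (MvPolynomial σ K) f =
      rename (fun w => e (Sum.inr w)) f) :
    Function.Bijective (aeval (fun t => X (e (Sum.inl t))) :
      MvPolynomial τ (MvPolynomial ω K) →ₐ[MvPolynomial ω K] MvPolynomial σ K) := by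
  let Φ := (sumAlgEquiv K τ ω).symm.trans (renameEquiv K e)
  have key : (aeval (fun t => X (e (Sum.inl t))) : MvPolynomial τ (MvPolynomial ω K)
      →ₐ[MvPolynomial ω K] MvPolynomial σ K).toRingHom = Φ.toRingEquiv.toRingHom := by
    refine MvPolynomial.ringHom_ext' (MvPolynomial.ringHom_ext' ?_ ?_) ?_
    · ext a
      simp [Φ, h]
    · intro w
      simp [Φ, h]
    · intro t
      simp [Φ]
  have h2 : ⇑(aeval (fun t => X (e (Sum.inl t))) : MvPolynomial τ (MvPolynomial ω K)
      →ₐ[MvPolynomial ω K] MvPolynomial σ K) = Φ := by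
    ext1 x
    exact congrArg (fun g : _ →+* _ => g x) key
  rw [h2]
  exact Φ.bijective

lemma flat_rename {K σ ω : Type*} [CommRing K] {f : ω → σ} (hf : Function.Injective f) :
    (rename f : MvPolynomial ω K →ₐ[K] MvPolynomial σ K).toRingHom.Flat := by
  classical
  let _ : Algebra (MvPolynomial ω K) (MvPolynomial σ K) :=
    (rename f : MvPolynomial ω K →ₐ[K] MvPolynomial σ K).toRingHom.toAlgebra
  let e : {p // ¬ p ∈ Set.range f} ⊕ ω ≃ σ :=
    ((Equiv.sumComm _ _).trans (Equiv.sumCongr (Equiv.ofInjective f hf) (Equiv.refl _))).trans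
      (Equiv.sumCompl (· ∈ Set.range f))
  have := bijective_aeval_of_equiv (K := K) e (fun f => rfl)
  exact Module.Flat.of_linearEquiv (AlgEquiv.ofBijective _ this).toLinearEquiv.symm

/-- The positions in the band form `m` rows of length `e`. -/
def bandEquiv (m e : ℕ) : Fin m × Fin e ≃ bandCells m (m + e) where
  toFun p := ⟨(p.1, ⟨p.1.val + p.2.val, by omega⟩), by simp [bandCells]; omega⟩
  invFun p := (p.1.1, ⟨p.1.2.val - p.1.1.val, by have := p.2; simp [bandCells] at this; omega⟩)
  left_inv p := by ext <;> simp
  right_inv p := by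
    have := p.2
    simp only [bandCells, Set.mem_ofPred_eq] at this
    ext <;> simp
    omega

universe u

lemma torVanFrom_minorsIdeal_pow (K : Type u) [CommRing K] [Nontrivial K] (m e k : ℕ) :
    TorVanFrom (MvPolynomial (Fin m × Fin (m + e)) K)
      ↥(minorsIdeal m (genMat K m (m + e)) ^ k) (m * e) := by
  classical
  let _ : Algebra (MvPolynomial (OffBand m (m + e)) K) (MvPolynomial (Fin m × Fin (m + e)) K) :=
    (rename Subtype.val : MvPolynomial (OffBand m (m + e)) K →ₐ[K] _).toRingHom.toAlgebra
  have h : ∀ f, algebraMap (MvPolynomial (OffBand m (m + e)) K)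
      (MvPolynomial (Fin m × Fin (m + e)) K) f = rename Subtype.val f := fun _ => rfl
  have hflat := flat_minorsIdeal_pow (k := k) K h
  have h0 : TorVanFrom (MvPolynomial (OffBand m (m + e)) K)
      ↥(minorsIdeal m (genMat K m (m + e)) ^ k) 0 := fun i _ N => torVan_of_flat_left i N
  have := TorVanFrom.of_aeval_bijective (m * e) _
    (bijective_aeval_of_equiv ((Equiv.sumCongr (finProdFinEquiv.symm.trans (bandEquiv m e))
      (Equiv.refl _)).trans (Equiv.sumCompl (· ∈ bandCells m (m + e)))) h) h0
  rwa [zero_add] at this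

lemma isSES_subtype_mkQ {B : Type u} [CommRing B] (I : Ideal B) :
    IsSES (Submodule.subtype I) (Submodule.mkQ I) :=
  ⟨Submodule.injective_subtype I, LinearMap.exact_subtype_mkQ I, Submodule.mkQ_surjective I⟩

lemma torVanFrom_quotient_minorsIdeal_pow (K : Type u) [CommRing K] [Nontrivial K] (m e k : ℕ) :
    TorVanFrom (MvPolynomial (Fin m × Fin (m + e)) K)
      (MvPolynomial (Fin m × Fin (m + e)) K ⧸ minorsIdeal m (genMat K m (m + e)) ^ k)
      (m * e + 1) := by
  intro i hi N _ _
  obtain ⟨i, rfl⟩ : ∃ j, i = j + 1 := ⟨i - 1, by omega⟩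
  rw [torVan_succ_iff_left (isSES_subtype_mkQ _)]
  exact torVanFrom_minorsIdeal_pow K m e k i (by omega) N

end FlatDimension

section TorsionIdeal

universe u

lemma torTorsion_of_mem_span {B S : Type u} [CommRing B] [CommRing S] [Algebra B S] (s : Set S)
    (i : ℕ) : ∀ (N : Type u) [AddCommGroup N] [Module B N],
    (∀ g ∈ s, TorTorsion B S (Algebra.lsmul B B S g) i N) →
    ∀ r ∈ Ideal.span s, TorTorsion B S (Algebra.lsmul B B S r) i N := by
  induction i with
  | succ i ih => exact fun N _ _ h => ih _ h
  | zero =>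
    intro N _ _ h r hr x hx
    have hsmul : ∀ (g : S) (n : ℕ) (x : TensorProduct B S (Syz B N)),
        ((Algebra.lsmul B B S g) ^ n).rTensor (Syz B N) x = g ^ n • x := by
      intro g n x
      rw [← map_pow]
      induction x using TensorProduct.induction_on with
      | zero => simp
      | tmul a b => rfl
      | add a b ha hb => rw [map_add, smul_add, ha, hb]
    have hrad : Ideal.span s ≤ (Ideal.torsionOf S (TensorProduct B S (Syz B N)) x).radical := by
      refine Ideal.span_le.2 fun g hg => ?_
      obtain ⟨n, hn⟩ := h g hg x hx
      exact ⟨n, by rw [Ideal.mem_torsionOf_iff, ← hsmul, hn]⟩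
    obtain ⟨n, hn⟩ := hrad hr
    exact ⟨n, by rw [hsmul]; exact (Ideal.mem_torsionOf_iff _ _).1 hn⟩

end TorsionIdeal

section Schur

variable {R : Type*} [CommRing R]

lemma det_add_mul_mem {j : ℕ} (N : Matrix (Fin (j + 1)) (Fin (j + 1)) R) (c r : Fin (j + 1) → R)
    (P : Ideal R) (hP : ∀ p q, (N.submatrix (Fin.succAbove p) (Fin.succAbove q)).det ∈ P) :
    (Matrix.of fun p q => N p q + c p * r q).det ∈ P := by
  let M : Matrix (Fin (j + 2)) (Fin (j + 2)) R :=
    Matrix.of (Fin.cons (Fin.cons 1 0) fun p => Fin.cons (c p) fun q => N p q + c p * r q)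
  let Q : Matrix (Fin (j + 2)) (Fin (j + 2)) R :=
    Matrix.of (Fin.cons (Fin.cons 1 fun q => - r q) fun p => Fin.cons (c p) (N p))
  have hM : (Matrix.of fun p q => N p q + c p * r q).det = M.det := by
    rw [Matrix.det_succ_row_zero M, Fin.sum_univ_succ, Finset.sum_eq_zero, add_zero]
    · simp only [M, Fin.val_zero, pow_zero, one_mul, Matrix.of_apply, Fin.cons_zero]
      congr 1
    · intro q _
      simp [M]
  have hMQ : Mᵀ.det = Qᵀ.det := by
    refine Matrix.det_eq_of_forall_row_eq_smul_add_const (Fin.cons 0 r) 0 rfl fun q p => ?_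
    cases q using Fin.cases <;> cases p using Fin.cases <;> simp [M, Q, mul_comm]
  have hN : N.det ∈ P := by
    rw [Matrix.det_succ_row_zero]
    exact Ideal.sum_mem _ fun q _ => Ideal.mul_mem_left _ _ (hP 0 q)
  rw [hM, ← Matrix.det_transpose, hMQ, Matrix.det_transpose, Matrix.det_succ_row_zero,
    Fin.sum_univ_succ]
  refine add_mem (Ideal.mul_mem_left _ _ hN) (Ideal.sum_mem _ fun q _ => Ideal.mul_mem_left _ _ ?_)
  rw [Matrix.det_succ_column_zero]
  refine Ideal.sum_mem _ fun p _ => Ideal.mul_mem_left _ _ ?_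
  convert hP p q using 2
  ext a b
  simp [Q]

variable {m n : ℕ}

/-- The Schur complement of the entry at `(i₀, j₀)`, whose inverse is `u`. -/
def schurCompl (A : Matrix (Fin (m + 1)) (Fin (n + 1)) R) (i₀ : Fin (m + 1)) (j₀ : Fin (n + 1))
    (u : R) : Matrix (Fin m) (Fin n) R :=
  Matrix.of fun i j => A (i₀.succAbove i) (j₀.succAbove j) -
    A (i₀.succAbove i) j₀ * u * A i₀ (j₀.succAbove j)

variable (A : Matrix (Fin (m + 1)) (Fin (n + 1)) R) {i₀ : Fin (m + 1)} {j₀ : Fin (n + 1)} {u : R}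

lemma exists_eq_succAbove_comp {ι : Type*} {l : ℕ} {i : Fin (l + 1)} {f : ι → Fin (l + 1)}
    (hf : Function.Injective f) (h : ∀ a, f a ≠ i) :
    ∃ f' : ι → Fin l, Function.Injective f' ∧ f = i.succAbove ∘ f' := by
  choose f' hf' using fun a => Fin.exists_succAbove_eq (h a)
  refine ⟨f', fun a b hab => hf ?_, funext fun a => (hf' a).symm⟩
  rw [← hf' a, ← hf' b, hab]

lemma minorsIdeal_succ_le_schurCompl (hu : A i₀ j₀ * u = 1) (j : ℕ) :
    minorsIdeal (j + 1) A ≤ minorsIdeal j (schurCompl A i₀ j₀ u) := by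
  refine Ideal.span_le.2 ?_
  rintro _ ⟨f, g, hf, hg, rfl⟩
  have h1 : A.submatrix f g = Matrix.of fun p q =>
      (A (f p) (g q) - A (f p) j₀ * u * A i₀ (g q)) + (A (f p) j₀ * u) * A i₀ (g q) := by
    ext p q; simp
  rw [h1]
  refine det_add_mul_mem (Matrix.of fun p q => A (f p) (g q) - A (f p) j₀ * u * A i₀ (g q)) _ _ _ ?_
  intro p q
  by_cases hi : ∃ a, f (p.succAbove a) = i₀
  · obtain ⟨a, ha⟩ := hi
    rw [Matrix.det_eq_zero_of_row_eq_zero a]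
    · exact zero_mem _
    · intro b
      simp [ha, hu]
  by_cases hj : ∃ b, g (q.succAbove b) = j₀
  · obtain ⟨b, hb⟩ := hj
    rw [Matrix.det_eq_zero_of_column_eq_zero b]
    · exact zero_mem _
    · intro a
      simp only [Matrix.submatrix_apply, Matrix.of_apply, hb]
      linear_combination (-A (f (p.succAbove a)) j₀) * hu
  push Not at hi hj
  obtain ⟨f', hf', hff'⟩ := exists_eq_succAbove_comp
    (hf.comp Fin.succAbove_right_injective) hi
  obtain ⟨g', hg', hgg'⟩ := exists_eq_succAbove_comp
    (hg.comp Fin.succAbove_right_injective) hj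
  refine Ideal.subset_span ⟨f', g', hf', hg', ?_⟩
  congr 1
  ext a b
  have ha := congrFun hff' a
  have hb := congrFun hgg' b
  simp only [Function.comp_apply] at ha hb
  simp [schurCompl, ha, hb]

lemma minorsIdeal_schurCompl_le (hu : A i₀ j₀ * u = 1) (j : ℕ) :
    minorsIdeal j (schurCompl A i₀ j₀ u) ≤ minorsIdeal (j + 1) A := by
  refine Ideal.span_le.2 ?_
  rintro _ ⟨f, g, hf, hg, rfl⟩
  let f' : Fin (j + 1) → Fin (m + 1) := Fin.cons i₀ (i₀.succAbove ∘ f)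
  let g' : Fin (j + 1) → Fin (n + 1) := Fin.cons j₀ (j₀.succAbove ∘ g)
  have hf' : Function.Injective f' := Fin.cons_injective_iff.2
    ⟨by simp [Fin.succAbove_ne], Fin.succAbove_right_injective.comp hf⟩
  have hg' : Function.Injective g' := Fin.cons_injective_iff.2
    ⟨by simp [Fin.succAbove_ne], Fin.succAbove_right_injective.comp hg⟩
  let Q : Matrix (Fin (j + 1)) (Fin (j + 1)) R := Matrix.of (Fin.cons (fun q => A i₀ (g' q))
    fun p => Fin.cons 0 (((schurCompl A i₀ j₀ u).submatrix f g) p))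
  have h1 : (A.submatrix f' g').det = Q.det := by
    refine Matrix.det_eq_of_forall_row_eq_smul_add_const
      (Fin.cons 0 fun p => A (i₀.succAbove (f p)) j₀ * u) 0 rfl fun p q => ?_
    cases p using Fin.cases <;> cases q using Fin.cases <;> simp [f', g', Q, schurCompl]
    rename_i p
    linear_combination (-A (i₀.succAbove (f p)) j₀) * hu
  have h2 : Q.det = A i₀ j₀ * ((schurCompl A i₀ j₀ u).submatrix f g).det := by
    rw [Matrix.det_succ_column_zero, Fin.sum_univ_succ, Finset.sum_eq_zero, add_zero]
    · simp only [Q, Fin.val_zero, pow_zero, one_mul, Matrix.of_apply, Fin.cons_zero]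
      congr 1
    · intro q _
      simp [Q]
  have h3 : ((schurCompl A i₀ j₀ u).submatrix f g).det = u * (A.submatrix f' g').det := by
    rw [h1, h2]
    linear_combination (-((schurCompl A i₀ j₀ u).submatrix f g).det) * hu
  rw [h3]
  exact Ideal.mul_mem_left _ _ (Ideal.subset_span ⟨f', g', hf', hg', rfl⟩)

lemma minorsIdeal_succ_eq_schurCompl (hu : A i₀ j₀ * u = 1) (j : ℕ) :
    minorsIdeal (j + 1) A = minorsIdeal j (schurCompl A i₀ j₀ u) :=
  le_antisymm (minorsIdeal_succ_le_schurCompl A hu j) (minorsIdeal_schurCompl_le A hu j)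

lemma minorsIdeal_map {S α β : Type*} [CommRing S] (φ : R →+* S) (t : ℕ) (M : Matrix α β R) :
    (minorsIdeal t M).map φ = minorsIdeal t (M.map φ) := by
  rw [minorsIdeal, minorsIdeal, Ideal.map_span]
  congr 1
  ext z
  constructor
  · rintro ⟨_, ⟨f, g, hf, hg, rfl⟩, rfl⟩
    exact ⟨f, g, hf, hg, by rw [RingHom.map_det]; rfl⟩
  · rintro ⟨f, g, hf, hg, rfl⟩
    exact ⟨_, ⟨f, g, hf, hg, rfl⟩, by rw [RingHom.map_det]; rfl⟩

lemma minorsIdeal_one_le {α β : Type*} (M : Matrix α β R) :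
    minorsIdeal 1 M ≤ Ideal.span {z | ∃ i j, z = M i j} := by
  refine Ideal.span_le.2 ?_
  rintro _ ⟨f, g, -, -, rfl⟩
  rw [Matrix.det_fin_one]
  exact Ideal.subset_span ⟨_, _, rfl⟩

lemma minorsIdeal_zero {α β : Type*} (M : Matrix α β R) : minorsIdeal 0 M = ⊤ := by
  rw [Ideal.eq_top_iff_one]
  exact Ideal.subset_span ⟨Fin.elim0, Fin.elim0, fun a => a.elim0, fun a => a.elim0, by simp⟩

end Schur

section SchurFlat

open MvPolynomial

variable {K : Type*} [CommRing K] {m n : ℕ} (i₀ : Fin (m + 1)) (j₀ : Fin (n + 1))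
variable {D : Type*} [CommRing D] [Algebra (MvPolynomial (Fin (m + 1) × Fin (n + 1)) K) D] (u : D)

/-- The substitution adding `ε` times the rank one correction to the entries outside the row `i₀`
and the column `j₀`. -/
noncomputable def shearHom (ε : ℤ) : MvPolynomial (Fin (m + 1) × Fin (n + 1)) K →+* D :=
  eval₂Hom ((algebraMap (MvPolynomial (Fin (m + 1) × Fin (n + 1)) K) D).comp C) fun p =>
    if p.1 ≠ i₀ ∧ p.2 ≠ j₀ then
      algebraMap (MvPolynomial (Fin (m + 1) × Fin (n + 1)) K) D (X p) +
        ε * (algebraMap (MvPolynomial (Fin (m + 1) × Fin (n + 1)) K) D (X (p.1, j₀)) * u *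
          algebraMap (MvPolynomial (Fin (m + 1) × Fin (n + 1)) K) D (X (i₀, p.2)))
    else algebraMap (MvPolynomial (Fin (m + 1) × Fin (n + 1)) K) D (X p)

/-- The homomorphism sending the generic matrix to the Schur complement of an entry. -/
noncomputable def schurHom : MvPolynomial (Fin m × Fin n) K →+* D :=
  eval₂Hom ((algebraMap (MvPolynomial (Fin (m + 1) × Fin (n + 1)) K) D).comp C) fun p =>
    schurCompl ((genMat K (m + 1) (n + 1)).map
      (algebraMap (MvPolynomial (Fin (m + 1) × Fin (n + 1)) K) D)) i₀ j₀ u p.1 p.2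

lemma genMat_map_schurHom : (genMat K m n).map (schurHom i₀ j₀ u) =
    schurCompl ((genMat K (m + 1) (n + 1)).map
      (algebraMap (MvPolynomial (Fin (m + 1) × Fin (n + 1)) K) D)) i₀ j₀ u := by
  ext i j
  simp [genMat, schurHom]

variable {u}

lemma flat_schurHom [IsLocalization.Away
    (X (i₀, j₀) : MvPolynomial (Fin (m + 1) × Fin (n + 1)) K) D]
    (hu : algebraMap (MvPolynomial (Fin (m + 1) × Fin (n + 1)) K) D (X (i₀, j₀)) * u = 1) :
    (schurHom (K := K) i₀ j₀ u).Flat := by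
  have hx : ∀ ε : ℤ, shearHom (K := K) i₀ j₀ u ε (X (i₀, j₀)) =
      algebraMap (MvPolynomial (Fin (m + 1) × Fin (n + 1)) K) D (X (i₀, j₀)) := by
    intro ε; simp [shearHom]
  have hunit : ∀ ε : ℤ, IsUnit (shearHom (K := K) i₀ j₀ u ε (X (i₀, j₀))) := by
    intro ε
    rw [hx]
    exact IsUnit.of_mul_eq_one _ hu
  let θ : ℤ → D →+* D := fun ε => IsLocalization.Away.lift (X (i₀, j₀)) (hunit ε)
  have hθ : ∀ ε b, θ ε (algebraMap (MvPolynomial (Fin (m + 1) × Fin (n + 1)) K) D b) = shearHom (K := K) i₀ j₀ u ε b := by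
    intro ε b
    exact IsLocalization.Away.lift_eq _ (hunit ε) b
  have hθu : ∀ ε, θ ε u = u := by
    intro ε
    have h1 := congrArg (θ ε) hu
    rw [map_mul, hθ, hx, map_one] at h1
    calc θ ε u = θ ε u * (algebraMap (MvPolynomial (Fin (m + 1) × Fin (n + 1)) K) D (X (i₀, j₀)) * u) := by rw [hu, mul_one]
      _ = (algebraMap (MvPolynomial (Fin (m + 1) × Fin (n + 1)) K) D (X (i₀, j₀)) * θ ε u) * u := by ring
      _ = u := by rw [h1, one_mul]
  have hX : ∀ ε p, shearHom (K := K) i₀ j₀ u ε (X p) = if p.1 ≠ i₀ ∧ p.2 ≠ j₀ then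
      algebraMap (MvPolynomial (Fin (m + 1) × Fin (n + 1)) K) D (X p) +
        ε * (algebraMap (MvPolynomial (Fin (m + 1) × Fin (n + 1)) K) D (X (p.1, j₀)) * u *
          algebraMap (MvPolynomial (Fin (m + 1) × Fin (n + 1)) K) D (X (i₀, p.2)))
    else algebraMap (MvPolynomial (Fin (m + 1) × Fin (n + 1)) K) D (X p) := by
    intro ε p
    rw [shearHom, coe_eval₂Hom, eval₂_X]
  have hC : ∀ ε a, shearHom (K := K) i₀ j₀ u ε (C a) = algebraMap (MvPolynomial (Fin (m + 1) × Fin (n + 1)) K) D (C a) := by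
    intro ε a
    simp [shearHom]
  have hinv : ∀ ε, (θ ε).comp (θ (-ε)) = RingHom.id D := by
    intro ε
    refine IsLocalization.ringHom_ext (Submonoid.powers
      (X (i₀, j₀) : MvPolynomial (Fin (m + 1) × Fin (n + 1)) K)) ?_
    refine MvPolynomial.ringHom_ext (fun a => ?_) fun p => ?_
    · simp only [RingHom.comp_apply, hθ, hC, RingHom.id_apply]
    · simp only [RingHom.comp_apply, hθ, hX, RingHom.id_apply]
      by_cases hp : p.1 ≠ i₀ ∧ p.2 ≠ j₀
      · rw [if_pos hp]
        simp only [map_add, map_mul, hθ, hθu, hX, map_intCast, if_pos hp]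
        simp
      · rw [if_neg hp, hθ, hX, if_neg hp]
  have hbij : Function.Bijective (θ (-1)) := by
    have h1 := hinv 1
    have h2 := hinv (-1)
    rw [neg_neg] at h2
    exact Function.bijective_iff_has_inverse.2 ⟨θ 1, fun x => RingHom.congr_fun h1 x,
      fun x => RingHom.congr_fun h2 x⟩
  have hfac : schurHom (K := K) i₀ j₀ u = ((θ (-1)).comp
      (algebraMap (MvPolynomial (Fin (m + 1) × Fin (n + 1)) K) D)).comp
        (rename (Prod.map i₀.succAbove j₀.succAbove) : MvPolynomial (Fin m × Fin n) K →ₐ[K]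
          MvPolynomial (Fin (m + 1) × Fin (n + 1)) K).toRingHom := by
    refine MvPolynomial.ringHom_ext (fun a => ?_) fun p => ?_
    · simp [schurHom, hθ, hC]
    · simp [schurHom, hθ, hX, schurCompl, genMat, Fin.succAbove_ne, sub_eq_add_neg]
      rfl
  rw [hfac]
  refine RingHom.Flat.comp (flat_rename (Fin.succAbove_right_injective.prodMap
    Fin.succAbove_right_injective)) (RingHom.Flat.comp ?_ (RingHom.Flat.of_bijective hbij))
  rw [RingHom.flat_algebraMap_iff]
  exact IsLocalization.flat D (Submonoid.powers
    (X (i₀, j₀) : MvPolynomial (Fin (m + 1) × Fin (n + 1)) K))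

end SchurFlat

section MainInduction

open MvPolynomial RingTheory.Sequence

universe u

variable {K : Type u} [CommRing K] {m n : ℕ}

lemma torVan_of_schurCompl (i₀ : Fin (m + 1)) (j₀ : Fin (n + 1)) {L : Type u} [CommRing L]
    [Algebra (MvPolynomial (Fin (m + 1) × Fin (n + 1)) K) L] {u : L}
    (hu : algebraMap (MvPolynomial (Fin (m + 1) × Fin (n + 1)) K) L (X (i₀, j₀)) * u = 1)
    (i k : ℕ) (H : ∀ [Algebra (MvPolynomial (Fin m × Fin n) K) L],
      (genMat K m n).map (algebraMap (MvPolynomial (Fin m × Fin n) K) L) =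
        schurCompl ((genMat K (m + 1) (n + 1)).map
          (algebraMap (MvPolynomial (Fin (m + 1) × Fin (n + 1)) K) L)) i₀ j₀ u →
      TorVan (MvPolynomial (Fin m × Fin n) K) L i
        (MvPolynomial (Fin m × Fin n) K ⧸ minorsIdeal m (genMat K m n) ^ k)) :
    TorVan (MvPolynomial (Fin (m + 1) × Fin (n + 1)) K) L i
      (MvPolynomial (Fin (m + 1) × Fin (n + 1)) K ⧸
        minorsIdeal (m + 1) (genMat K (m + 1) (n + 1)) ^ k) := by
  obtain ⟨D, _, _, _⟩ : ∃ (D : Type u) (_ : CommRing D)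
      (_ : Algebra (MvPolynomial (Fin (m + 1) × Fin (n + 1)) K) D),
      IsLocalization.Away (X (i₀, j₀) : MvPolynomial (Fin (m + 1) × Fin (n + 1)) K) D :=
    ⟨Localization.Away (X (i₀, j₀) : MvPolynomial (Fin (m + 1) × Fin (n + 1)) K), inferInstance, inferInstance, inferInstance⟩
  let _ : Algebra D L := (IsLocalization.Away.lift (S := D) (X (i₀, j₀))
    (IsUnit.of_mul_eq_one _ hu)).toAlgebra
  have _ : IsScalarTower (MvPolynomial (Fin (m + 1) × Fin (n + 1)) K) D L :=
    IsScalarTower.of_algebraMap_eq fun b =>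
      (IsLocalization.Away.lift_eq _ (IsUnit.of_mul_eq_one _ hu) b).symm
  have _ : Module.Flat (MvPolynomial (Fin (m + 1) × Fin (n + 1)) K) D :=
    IsLocalization.flat D (Submonoid.powers
      (X (i₀, j₀) : MvPolynomial (Fin (m + 1) × Fin (n + 1)) K))
  let v : D := IsLocalization.Away.invSelf (X (i₀, j₀) :
    MvPolynomial (Fin (m + 1) × Fin (n + 1)) K)
  have hv : algebraMap (MvPolynomial (Fin (m + 1) × Fin (n + 1)) K) D (X (i₀, j₀)) * v = 1 :=
    IsLocalization.Away.mul_invSelf _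
  have hvu : algebraMap D L v = u := by
    have h1 := congrArg (algebraMap D L) hv
    rw [map_mul, map_one, ← IsScalarTower.algebraMap_apply] at h1
    calc algebraMap D L v = algebraMap D L v *
          (algebraMap (MvPolynomial (Fin (m + 1) × Fin (n + 1)) K) L (X (i₀, j₀)) * u) := by
            rw [hu, mul_one]
      _ = (algebraMap (MvPolynomial (Fin (m + 1) × Fin (n + 1)) K) L (X (i₀, j₀)) *
          algebraMap D L v) * u := by ring
      _ = u := by rw [h1, one_mul]
  have hflat := flat_schurHom (K := K) i₀ j₀ hv
  let _ : Algebra (MvPolynomial (Fin m × Fin n) K) D := (schurHom (K := K) i₀ j₀ v).toAlgebra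
  have _ : Module.Flat (MvPolynomial (Fin m × Fin n) K) D := hflat
  let _ : Algebra (MvPolynomial (Fin m × Fin n) K) L :=
    ((algebraMap D L).comp (algebraMap (MvPolynomial (Fin m × Fin n) K) D)).toAlgebra
  have _ : IsScalarTower (MvPolynomial (Fin m × Fin n) K) D L :=
    IsScalarTower.of_algebraMap_eq fun _ => rfl
  have hmapD : (genMat K m n).map (algebraMap (MvPolynomial (Fin m × Fin n) K) D) =
      schurCompl ((genMat K (m + 1) (n + 1)).map
        (algebraMap (MvPolynomial (Fin (m + 1) × Fin (n + 1)) K) D)) i₀ j₀ v :=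
    genMat_map_schurHom i₀ j₀ v
  have hideal : (minorsIdeal (m + 1) (genMat K (m + 1) (n + 1)) ^ k).map
      (algebraMap (MvPolynomial (Fin (m + 1) × Fin (n + 1)) K) D) =
      (minorsIdeal m (genMat K m n) ^ k).map (algebraMap (MvPolynomial (Fin m × Fin n) K) D) := by
    rw [Ideal.map_pow, Ideal.map_pow, minorsIdeal_map, minorsIdeal_map, hmapD,
      ← minorsIdeal_succ_eq_schurCompl _ hv]
  rw [← torVan_quotient_map_iff (B := D), hideal, torVan_quotient_map_iff]
  refine H ?_
  ext a b
  have h2 := congrArg (algebraMap D L) (congrFun (congrFun hmapD a) b)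
  simp only [schurCompl, Matrix.map_apply, Matrix.of_apply, map_sub, map_mul, hvu,
    ← IsScalarTower.algebraMap_apply] at h2 ⊢
  exact h2

lemma torVan_of_subsingleton {B E N : Type u} [CommRing B] [AddCommGroup E] [Module B E]
    [AddCommGroup N] [Module B N] [Subsingleton N] (i : ℕ) : TorVan B E i N := by
  rw [torVan_comm]
  exact torVan_of_flat_left i E

variable (K) in
theorem torVan_quotient_minorsIdeal_pow [Nontrivial K] (e : ℕ) (m : ℕ) : ∀ (n : ℕ), n = m + e →
    ∀ (S : Type u) [CommRing S] [Algebra (MvPolynomial (Fin m × Fin n) K) S],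
    (∀ j, 1 ≤ j → j ≤ m → ∃ rs : List S, rs.length = (m - j + 1) * e + 1 ∧
      (∀ r ∈ rs, r ∈ minorsIdeal j ((genMat K m n).map (algebraMap _ S))) ∧
        IsWeaklyRegular S rs) →
    ∀ i k, TorVan (MvPolynomial (Fin m × Fin n) K) S i
      (MvPolynomial (Fin m × Fin n) K ⧸ minorsIdeal m (genMat K m n) ^ k) := by
  induction m with
  | zero =>
    intro n _ S _ _ _ i k
    have _ : Subsingleton (MvPolynomial (Fin 0 × Fin n) K ⧸ minorsIdeal 0 (genMat K 0 n) ^ k) := by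
      rw [Ideal.Quotient.subsingleton_iff, minorsIdeal_zero, ← Ideal.one_eq_top, one_pow]
    exact torVan_of_subsingleton i
  | succ m ih =>
    intro n hn S _ _ H i k
    obtain ⟨n, rfl⟩ : ∃ n', n = n' + 1 := ⟨m + e, by omega⟩
    obtain ⟨rs, hlen, hmem, hreg⟩ := H 1 le_rfl (by omega)
    have hdim : TorVanFrom (MvPolynomial (Fin (m + 1) × Fin (n + 1)) K)
        (MvPolynomial (Fin (m + 1) × Fin (n + 1)) K ⧸
          minorsIdeal (m + 1) (genMat K (m + 1) (n + 1)) ^ k) (0 + rs.length) := by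
      rw [hlen, zero_add, hn]
      exact torVanFrom_quotient_minorsIdeal_pow K (m + 1) e k
    refine torVan_of_isWeaklyRegular rs S 0 hreg ?_ hdim i (Nat.zero_le i)
    intro i _ r hr
    refine torTorsion_of_mem_span _ i _ ?_ r (minorsIdeal_one_le _ (hmem r hr))
    rintro _ ⟨i₀, j₀, rfl⟩
    refine torTorsion_of_torVan_away _ (Localization.Away ((genMat K (m + 1) (n + 1)).map
      (algebraMap (MvPolynomial (Fin (m + 1) × Fin (n + 1)) K) S) i₀ j₀)) i _ ?_
    generalize hg : (genMat K (m + 1) (n + 1)).map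
      (algebraMap (MvPolynomial (Fin (m + 1) × Fin (n + 1)) K) S) i₀ j₀ = g
    have hgX : algebraMap (MvPolynomial (Fin (m + 1) × Fin (n + 1)) K) S (X (i₀, j₀)) = g := hg
    have hu : algebraMap (MvPolynomial (Fin (m + 1) × Fin (n + 1)) K) (Localization.Away g)
        (X (i₀, j₀)) * IsLocalization.Away.invSelf g = 1 := by
      rw [IsScalarTower.algebraMap_apply _ S, hgX]
      exact IsLocalization.Away.mul_invSelf g
    refine torVan_of_schurCompl i₀ j₀ hu i k ?_
    intro _ hschur
    refine ih n (by omega) (Localization.Away g) ?_ i k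
    intro j hj1 hjm
    obtain ⟨rs, hlen, hmem, hreg⟩ := H (j + 1) (by omega) (by omega)
    refine ⟨rs.map (algebraMap S (Localization.Away g)), ?_, ?_,
      hreg.of_isLocalization _ (Submonoid.powers g)⟩
    · rw [List.length_map, hlen]
      congr 3
      omega
    · intro r hr
      obtain ⟨r, hr', rfl⟩ := List.mem_map.1 hr
      rw [hschur, ← minorsIdeal_succ_eq_schurCompl _ hu]
      have := Ideal.mem_map_of_mem (algebraMap S (Localization.Away g)) (hmem r hr')
      rw [minorsIdeal_map, Matrix.map_map] at this
      exact this

end MainInduction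

section Assembly

open MvPolynomial RingTheory.Sequence TensorProduct

universe u

lemma range_lid_comp_map_subtype {B R : Type*} [CommRing B] [CommRing R] [Algebra B R]
    (J : Ideal B) :
    Set.range ((TensorProduct.lid B R).toLinearMap.comp
      (TensorProduct.map (Submodule.subtype J) (LinearMap.id : R →ₗ[B] R))) =
    (J.map (algebraMap B R) : Set R) := by
  ext z
  constructor
  · rintro ⟨x, rfl⟩
    induction x using TensorProduct.induction_on with
    | zero => simp
    | tmul a r =>
      simp only [LinearMap.comp_apply, TensorProduct.map_tmul, LinearEquiv.coe_coe,
        TensorProduct.lid_tmul, Submodule.subtype_apply, LinearMap.id_apply, Algebra.smul_def]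
      exact Ideal.mul_mem_right _ _ (Ideal.mem_map_of_mem _ a.2)
    | add x y hx hy => rw [map_add]; exact add_mem hx hy
  · intro hz
    rw [← LinearMap.coe_range]
    refine Submodule.closure_induction (zero_mem _) (fun _ _ _ _ => add_mem) ?_ hz
    rintro r _ ⟨a, ha, rfl⟩
    refine ⟨⟨a, ha⟩ ⊗ₜ r, ?_⟩
    simp [Algebra.smul_def, mul_comm]

lemma injective_lid_comp_map_subtype_iff {B R : Type u} [CommRing B] [CommRing R] [Algebra B R]
    (J : Ideal B) :
    Function.Injective ((TensorProduct.lid B R).toLinearMap.comp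
      (TensorProduct.map (Submodule.subtype J) (LinearMap.id : R →ₗ[B] R))) ↔
    TorVan B R 0 (B ⧸ J) := by
  rw [torVan_zero_iff_lTensor (isSES_subtype_mkQ J), LinearMap.lTensor_inj_iff_rTensor_inj,
    LinearMap.coe_comp]
  exact (TensorProduct.lid B R).injective.of_comp_iff _

lemma exists_isWeaklyRegular_of_le_idealHeight {K : Type*} [Field K] {d h : ℕ}
    {I : Ideal (MvPolynomial (Fin d) K)} (hI : (h : ℕ∞) ≤ idealHeight I) :
    ∃ rs : List (MvPolynomial (Fin d) K), rs.length = h ∧ (∀ r ∈ rs, r ∈ I) ∧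
      IsWeaklyRegular (MvPolynomial (Fin d) K) rs := by
  refine exists_isWeaklyRegular_of_le_height d h I fun p hp hIp => ?_
  refine (hI.trans (iInf₂_le (⟨p, hp⟩ : PrimeSpectrum _) hIp)).trans_eq ?_
  exact (PrimeSpectrum.height_eq_orderHeight ⟨p, hp⟩).symm

lemma flat_mvPolynomial_map (K σ τ : Type*) [CommRing K] :
    (MvPolynomial.map (C : K →+* MvPolynomial τ K) :
      MvPolynomial σ K →+* MvPolynomial σ (MvPolynomial τ K)).Flat := by
  have h : (MvPolynomial.map (C : K →+* MvPolynomial τ K) :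
      MvPolynomial σ K →+* MvPolynomial σ (MvPolynomial τ K)) =
      (sumAlgEquiv K σ τ).toRingEquiv.toRingHom.comp
        (rename Sum.inl : MvPolynomial σ K →ₐ[K] _).toRingHom := by
    refine MvPolynomial.ringHom_ext (fun a => ?_) fun p => ?_ <;> simp
  rw [h]
  exact RingHom.Flat.comp (flat_rename Sum.inl_injective)
    (RingHom.Flat.of_bijective (sumAlgEquiv K σ τ).bijective)

end Assembly

theorem statement_13 (K : Type*) [Field K] (d : ℕ) (hd : 0 < d)
    (m n : ℕ) (h1m : 1 ≤ m) (hmn : m ≤ n)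
    (A : Matrix (Fin m) (Fin n) (MvPolynomial (Fin d) K))
    (hgen : idealHeight (minorsIdeal m A) = ((n - m + 1 : ℕ) : ℕ∞))
    (hj : ∀ j : ℕ, 1 ≤ j → j ≤ m - 1 →
      (((m - j + 1) * (n - m) + 1 : ℕ) : ℕ∞) ≤ idealHeight (minorsIdeal j A)) :
    ∀ k : ℕ, 0 < k →
      let R := MvPolynomial (Fin d) K
      let B := MvPolynomial (Fin m × Fin n) R
      let X : Matrix (Fin m) (Fin n) B := Matrix.of fun i j => MvPolynomial.X (i, j)
      let J : Ideal B := minorsIdeal m X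
      let I : Ideal R := minorsIdeal m A
      letI : Algebra B R :=
        ((MvPolynomial.aeval fun p : Fin m × Fin n => A p.1 p.2 : B →ₐ[R] R)).toRingHom.toAlgebra
      letI : Module B B := Semiring.toModule
      let ψ : TensorProduct B (↥(J ^ k)) R →ₗ[B] R :=
        (TensorProduct.lid B R).toLinearMap.comp
          (TensorProduct.map (Submodule.subtype (J ^ k)) LinearMap.id)
      Function.Injective ψ ∧ Set.range ψ = ((I ^ k : Ideal R) : Set R) := by
  intro k _ R B X J I ψ
  let _ : Algebra B R :=
    ((MvPolynomial.aeval fun p : Fin m × Fin n => A p.1 p.2 : B →ₐ[R] R)).toRingHom.toAlgebra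
  have hmap : X.map (algebraMap B R) = A := by
    ext1 i j
    exact MvPolynomial.aeval_X _ _
  refine ⟨?_, ?_⟩
  · refine (injective_lid_comp_map_subtype_iff (J ^ k)).2 ?_
    let C := MvPolynomial (Fin m × Fin n) K
    let _ : Algebra C B :=
      (MvPolynomial.map (MvPolynomial.C : K →+* R) : C →+* B).toAlgebra
    have _ : Module.Flat C B := flat_mvPolynomial_map K (Fin m × Fin n) (Fin d)
    let _ : Algebra C R := ((algebraMap B R).comp (algebraMap C B)).toAlgebra
    have _ : IsScalarTower C B R := IsScalarTower.of_algebraMap_eq fun _ => rfl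
    have hX : (genMat K m n).map (algebraMap C B) = X := by
      ext1 i j
      exact MvPolynomial.map_X _ _
    have hA : (genMat K m n).map (algebraMap C R) = A := by
      rw [← hmap, ← hX, Matrix.map_map]
      rfl
    have hJ : J ^ k = (minorsIdeal m (genMat K m n) ^ k).map (algebraMap C B) := by
      rw [Ideal.map_pow, minorsIdeal_map, hX]
    rw [hJ, torVan_quotient_map_iff]
    refine torVan_quotient_minorsIdeal_pow K (n - m) m n (by omega) R ?_ 0 k
    intro j hj1 hjm
    rw [hA]
    refine exists_isWeaklyRegular_of_le_idealHeight ?_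
    rcases hjm.eq_or_lt with rfl | hlt
    · rw [hgen, Nat.sub_self, zero_add, one_mul]
    · exact hj j hj1 (by omega)
  · rw [show I ^ k = (J ^ k).map (algebraMap B R) by rw [Ideal.map_pow, minorsIdeal_map, hmap]]
    exact range_lid_comp_map_subtype (J ^ k)
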